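/- arXiv:1303.0546 — 6 statements merged into one kernel-verified Lean document; each statement's English description precedes it below -/
import Mathlib

section
/- Let K be a field and let m, n be integers with 1 ≤ m ≤ n. In the polynomial ring R = K[X_{k,i} : 1 ≤ k ≤ 2n+1, 1 ≤ i ≤ m], the m(m+1)/2 quadratic polynomials x_{i,j} for 1 ≤ i ≤ j ≤ m, where x_{i,i} = Σ_{k=1}^{n} X_{k,i}X_{n+k,i} + X_{2n+1,i}^2 and, for i < j, x_{i,j} = Σ_{k=1}^{n} (X_{k,i} X_{n+k,j} + X_{n+k,i} X_{k,j}) + 2 X_{2n+1,i} X_{2n+1,j}, form a regular sequence; in particular R/(x_{i,j} : i ≤ j) is a complete intersection ring of Krull dimension (2n+1)m − m(m+1)/2. -/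
noncomputable section

open MvPolynomial

/-- The odd orthogonal quadric `x_{i,j}` for `i ≤ j`:
`x_{i,i} = ∑_{k=1}^{n} X_{k,i}X_{n+k,i} + X_{2n+1,i}²` and, for `i < j`,
`x_{i,j} = ∑_{k=1}^{n} (X_{k,i} X_{n+k,j} + X_{n+k,i} X_{k,j}) + 2 X_{2n+1,i} X_{2n+1,j}`. -/
def oddQuad (K : Type*) [Field K] (n m : ℕ) (i j : Fin m) :
    MvPolynomial (Fin (2 * n + 1) × Fin m) K :=
  if i = j then
    (∑ k : Fin n,
      X (⟨k.1, by have := k.2; omega⟩, i) * X (⟨n + k.1, by have := k.2; omega⟩, i))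
      + X (⟨2 * n, by omega⟩, i) ^ 2
  else
    (∑ k : Fin n,
      (X (⟨k.1, by have := k.2; omega⟩, i) * X (⟨n + k.1, by have := k.2; omega⟩, j)
        + X (⟨n + k.1, by have := k.2; omega⟩, i) * X (⟨k.1, by have := k.2; omega⟩, j)))
      + 2 * X (⟨2 * n, by omega⟩, i) * X (⟨2 * n, by omega⟩, j)

/-- The list of the quadrics `x_{i,j}` for `i ≤ j`, in lexicographic order. -/
def oddList (K : Type*) [Field K] (n m : ℕ) :
    List (MvPolynomial (Fin (2 * n + 1) × Fin m) K) :=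
  (List.finRange m).flatMap fun i =>
    ((List.finRange m).filter fun j => decide (i ≤ j)).map fun j => oddQuad K n m i j

/-- A linear endomorphism that differs from the identity by a map strictly lowering an exhaustive
filtration with `F 0 = ⊥` is bijective. -/
theorem LinearMap.bijective_of_sub_mem_filtration {R V : Type*} [CommRing R] [AddCommGroup V]
    [Module R V] (Ψ : V →ₗ[R] V) (F : ℕ → Submodule R V) (h0 : F 0 = ⊥)
    (hex : ∀ x, ∃ k, x ∈ F k) (hΨ : ∀ k, ∀ x ∈ F (k + 1), Ψ x - x ∈ F k) :
    Function.Bijective Ψ := by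
  constructor
  · rw [injective_iff_map_eq_zero]
    have key : ∀ k, ∀ x ∈ F k, Ψ x = 0 → x = 0 := by
      intro k
      induction k with
      | zero => intro x hx _; simpa [h0] using hx
      | succ k ih =>
        intro x hx h
        refine ih x ?_ h
        simpa [h] using hΨ k x hx
    intro x hx
    obtain ⟨k, hk⟩ := hex x
    exact key k x hk hx
  · have key : ∀ k, ∀ x ∈ F k, ∃ y, Ψ y = x := by
      intro k
      induction k with
      | zero => intro x hx; exact ⟨0, by simpa [h0, eq_comm] using hx⟩
      | succ k ih =>
        intro x hx
        obtain ⟨y, hy⟩ := ih _ (hΨ k x hx)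
        exact ⟨x - y, by simp [hy]⟩
    intro x
    obtain ⟨k, hk⟩ := hex x
    exact key k x hk

namespace MvPolynomial

section Weight

variable {σ R : Type*} [CommRing R] (wt : (σ →₀ ℕ) →+ ℕ)

variable (R) in
/-- The polynomials all of whose monomials have weight less than `k`. -/
def weightLT (k : ℕ) : Submodule R (MvPolynomial σ R) :=
  restrictSupport R {d | wt d < k}

variable {wt}

theorem mem_weightLT {k : ℕ} {p : MvPolynomial σ R} :
    p ∈ weightLT R wt k ↔ ∀ d ∈ p.support, wt d < k :=
  Iff.rfl

theorem weightLT_mono {k l : ℕ} (h : k ≤ l) : weightLT R wt k ≤ weightLT R wt l :=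
  restrictSupport_mono R fun _ hd => lt_of_lt_of_le hd h

theorem monomial_mem_weightLT {k : ℕ} {d : σ →₀ ℕ} (r : R) (h : wt d < k) :
    monomial d r ∈ weightLT R wt k :=
  (monomial_mem_restrictSupport R).2 (Or.inl h)

theorem mul_mem_weightLT {a b c : ℕ} (h : a + b ≤ c + 1) {p q : MvPolynomial σ R}
    (hp : p ∈ weightLT R wt a) (hq : q ∈ weightLT R wt b) : p * q ∈ weightLT R wt c := by
  classical
  rw [mem_weightLT] at *
  intro d hd
  obtain ⟨x, hx, y, hy, rfl⟩ := Finset.mem_add.1 (support_mul p q hd)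
  have := hp x hx
  have := hq y hy
  rw [map_add]
  omega

variable (wt) in
/-- `p` is the monomial `d` plus terms of smaller weight. -/
def HasWeightLead (p : MvPolynomial σ R) (d : σ →₀ ℕ) : Prop :=
  p - monomial d 1 ∈ weightLT R wt (wt d)

theorem HasWeightLead.mem {p : MvPolynomial σ R} {d : σ →₀ ℕ} (h : HasWeightLead wt p d) :
    p ∈ weightLT R wt (wt d + 1) := by
  have := add_mem (weightLT_mono (Nat.le_succ _) h)
    (monomial_mem_weightLT (1 : R) (Nat.lt_succ_self (wt d)))
  simpa using this

theorem hasWeightLead_monomial (d : σ →₀ ℕ) : HasWeightLead wt (monomial d (1 : R)) d := by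
  simp [HasWeightLead]

theorem HasWeightLead.mul {p q : MvPolynomial σ R} {d e : σ →₀ ℕ}
    (hp : HasWeightLead wt p d) (hq : HasWeightLead wt q e) :
    HasWeightLead wt (p * q) (d + e) := by
  have h : p * q - monomial (d + e) 1 =
      (p - monomial d 1) * q + monomial d 1 * (q - monomial e 1) := by
    have : monomial (d + e) (1 : R) = monomial d 1 * monomial e 1 := by
      rw [monomial_mul, one_mul]
    rw [this]
    ring
  rw [HasWeightLead, h, map_add]
  exact add_mem (mul_mem_weightLT (by omega) hp hq.mem)
    (mul_mem_weightLT (by omega) (monomial_mem_weightLT _ (Nat.lt_succ_self _)) hq)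

theorem HasWeightLead.pow {p : MvPolynomial σ R} {d : σ →₀ ℕ} (hp : HasWeightLead wt p d) (k : ℕ) :
    HasWeightLead wt (p ^ k) (k • d) := by
  induction k with
  | zero => simpa using hasWeightLead_monomial (R := R) (wt := wt) 0
  | succ k ih => rw [pow_succ, succ_nsmul]; exact ih.mul hp

theorem HasWeightLead.prod {ι : Type*} (s : Finset ι) {p : ι → MvPolynomial σ R} {d : ι → σ →₀ ℕ}
    (h : ∀ i ∈ s, HasWeightLead wt (p i) (d i)) :
    HasWeightLead wt (∏ i ∈ s, p i) (∑ i ∈ s, d i) := by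
  classical
  induction s using Finset.induction_on with
  | empty => simpa using hasWeightLead_monomial (R := R) (wt := wt) 0
  | insert a s ha ih =>
    rw [Finset.prod_insert ha, Finset.sum_insert ha]
    exact (h a (Finset.mem_insert_self a s)).mul
      (ih fun i hi => h i (Finset.mem_insert_of_mem hi))

/-- A linear map sending each monomial to itself plus terms of smaller weight is bijective. -/
theorem bijective_of_hasWeightLead (Ψ : MvPolynomial σ R →ₗ[R] MvPolynomial σ R)
    (h : ∀ d, HasWeightLead wt (Ψ (monomial d 1)) d) : Function.Bijective Ψ := by
  refine Ψ.bijective_of_sub_mem_filtration (weightLT R wt) ?_ ?_ ?_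
  · rw [eq_bot_iff]
    intro p hp
    rw [mem_weightLT] at hp
    rw [Submodule.mem_bot, ← support_eq_empty, Finset.eq_empty_iff_forall_notMem]
    exact fun d hd => Nat.not_lt_zero _ (hp d hd)
  · exact fun p => ⟨p.support.sup wt + 1, fun d hd => Nat.lt_succ_of_le (Finset.le_sup hd)⟩
  · intro k p hp
    have hsum : Ψ p - p = ∑ d ∈ p.support, coeff d p • (Ψ (monomial d 1) - monomial d 1) := by
      have e : p = ∑ d ∈ p.support, coeff d p • monomial d (1 : R) := by
        conv_lhs => rw [p.as_sum]
        simp [smul_monomial]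
      conv_lhs => rw [e]
      simp [smul_sub]
    rw [hsum]
    exact sum_mem fun d hd => Submodule.smul_mem _ _
      (weightLT_mono (Nat.lt_succ_iff.1 (hp hd)) (h d))

end Weight

open RingTheory.Sequence

/-- Monomials such that divisibility by an earlier one cannot be created by multiplication with
a later one form a weakly regular sequence. -/
theorem isWeaklyRegular_monomial {σ R : Type*} [CommRing R] (l : List (σ →₀ ℕ))
    (hl : l.Pairwise fun a b => ∀ x, a ≤ x + b → a ≤ x) :
    IsWeaklyRegular (MvPolynomial σ R) (l.map fun d => monomial d (1 : R)) := by
  refine ⟨fun i hi => ?_⟩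
  rw [List.length_map] at hi
  rw [isSMulRegular_quotient_iff_mem_of_smul_mem]
  have hI : (Ideal.ofList ((l.map fun d => monomial d (1 : R)).take i) • ⊤ :
      Submodule (MvPolynomial σ R) (MvPolynomial σ R)) =
      Ideal.span ((fun d => monomial d (1 : R)) '' {d | d ∈ l.take i}) := by
    rw [smul_eq_mul, Ideal.mul_top, Ideal.ofList]
    congr 1
    ext p
    simp [← List.map_take]
  rw [hI]
  intro p hp
  rw [mem_ideal_span_monomial_image] at hp ⊢
  intro d hd
  obtain ⟨a, ha, hle⟩ := hp (d + l[i]) (by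
    rw [mem_support_iff] at hd ⊢
    rwa [smul_eq_mul, List.getElem_map, mul_comm, coeff_mul_monomial, mul_one])
  refine ⟨a, ha, ?_⟩
  obtain ⟨j, hj, rfl⟩ := List.mem_take_iff_getElem.1 ha
  exact List.pairwise_iff_getElem.1 hl j i (by omega) hi (by omega) d hle

/-- Polynomials with coprime squarefree quadratic leading monomials `X (u p) * X (v p)`, with
respect to a weight, form a weakly regular sequence. -/
theorem isWeaklyRegular_of_hasWeightLead {σ R ι : Type*} [CommRing R] [Fintype ι]
    (wt : (σ →₀ ℕ) →+ ℕ) (t : ι ⊕ ι → σ) (ht : Function.Injective t) (f : ι → MvPolynomial σ R)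
    (hf : ∀ p, HasWeightLead wt (f p)
      (Finsupp.single (t (.inl p)) 1 + Finsupp.single (t (.inr p)) 1))
    (l : List ι) (hl : l.Nodup) :
    IsWeaklyRegular (MvPolynomial σ R) (l.map f) := by
  classical
  set L : ι → σ →₀ ℕ :=
    fun p => Finsupp.single (t (.inl p)) 1 + Finsupp.single (t (.inr p)) 1 with hL
  let e : (σ →₀ ℕ) → ι → ℕ := fun d p => min (d (t (.inl p))) (d (t (.inr p)))
  have heL (d p q) : e (d + L p) q = e d q + if q = p then 1 else 0 := by
    by_cases h : q = p
    · subst h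
      simp [e, hL, ht.eq_iff]
    · simp [e, hL, ht.eq_iff, h]
  have hle (d) : ∑ p, e d p • L p ≤ d := by
    intro a
    have h1 : (∑ p, e d p • L p) a =
        ∑ q : ι ⊕ ι, if t q = a then e d (Sum.elim id id q) else 0 := by
      rw [Fintype.sum_sum_type, ← Finset.sum_add_distrib, Finsupp.finsetSum_apply]
      refine Finset.sum_congr rfl fun p _ => ?_
      simp [hL, Finsupp.single_apply]
    rw [h1]
    by_cases ha : ∃ q, t q = a
    · obtain ⟨q, rfl⟩ := ha
      simp only [ht.eq_iff, Finset.sum_ite_eq', Finset.mem_univ, if_true]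
      cases q <;> simp [e]
    · push Not at ha
      simp [ha]
  let g : (σ →₀ ℕ) → MvPolynomial σ R :=
    fun d => monomial (d - ∑ p, e d p • L p) 1 * ∏ p, f p ^ e d p
  have hg (d) : HasWeightLead wt (g d) d := by
    have := (hasWeightLead_monomial (R := R) (wt := wt) (d - ∑ p, e d p • L p)).mul
      (HasWeightLead.prod Finset.univ fun p _ => (hf p).pow (e d p))
    rwa [tsub_add_cancel_of_le (hle d)] at this
  have hgL (d p) : g (d + L p) = f p * g d := by
    have h1 : ∑ q, e (d + L p) q • L q = (∑ q, e d q • L q) + L p := by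
      simp [heL, add_smul, Finset.sum_add_distrib]
    have h2 : ∏ q, f q ^ e (d + L p) q = (∏ q, f q ^ e d q) * f p := by
      simp only [heL, pow_add, Finset.prod_mul_distrib, pow_ite, pow_one, pow_zero]
      simp
    simp only [g]
    rw [h1, h2, add_tsub_add_eq_tsub_right]
    ring
  let Ψ : MvPolynomial σ R →ₗ[R] MvPolynomial σ R := (basisMonomials σ R).constr R g
  have hΨ (d) : Ψ (monomial d 1) = g d := by
    have := (basisMonomials σ R).constr_basis R g d
    rwa [coe_basisMonomials] at this
  have hbij : Function.Bijective Ψ := bijective_of_hasWeightLead Ψ fun d => by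
    rw [hΨ]
    exact hg d
  have hmul (p) (x : MvPolynomial σ R) : Ψ (monomial (L p) 1 * x) = f p * Ψ x := by
    induction x using MvPolynomial.induction_on' with
    | monomial d r =>
      have hr (d : σ →₀ ℕ) : monomial d r = r • monomial d (1 : R) := by simp [smul_monomial]
      rw [monomial_mul, one_mul, hr, hr, map_smul, map_smul, hΨ, hΨ, add_comm, hgL,
        mul_smul_comm]
    | add x y hx hy => rw [mul_add, map_add, map_add, mul_add, hx, hy]
  have hmon : IsWeaklyRegular (MvPolynomial σ R)
      ((l.map L).map fun d => monomial d (1 : R)) := by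
    refine isWeaklyRegular_monomial _ (List.pairwise_map.2 (hl.imp ?_))
    intro p q hpq x hx a
    have hxa : L p a ≤ x a + L q a := hx a
    by_cases h1 : a = t (.inl q)
    · simp [hL, h1, ht.eq_iff, hpq]
    by_cases h2 : a = t (.inr q)
    · simp [hL, h2, ht.eq_iff, hpq]
    have h0 : L q a = 0 := by simp [hL, h1, h2]
    rwa [h0, add_zero] at hxa
  refine (AddEquiv.isWeaklyRegular_congr (e := (LinearEquiv.ofBijective Ψ hbij).toAddEquiv)
    ?_).1 hmon
  rw [List.map_map, List.forall₂_map_left_iff, List.forall₂_map_right_iff]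
  exact List.forall₂_same.2 fun p _ x => hmul p x

end MvPolynomial

section Dimension

theorem WithBot.eq_natCast_sub_of_add_natCast_eq {d : WithBot ℕ∞} {r N : ℕ}
    (h : d + r = N) : d = (N - r : ℕ) := by
  induction d using WithBot.recBotCoe with
  | bot => simp at h
  | coe d =>
    induction d using ENat.recTopCoe with
    | top => exact absurd (WithBot.coe_inj.1 h) (by simp)
    | coe d =>
      have h' : d + r = N := by exact_mod_cast h
      rw [← h', Nat.add_sub_cancel]
      rfl

open RingTheory.Sequence Module

theorem Module.supportDim_add_length_le_of_isWeaklyRegular {R M : Type*} [CommRing R]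
    [IsNoetherianRing R] [AddCommGroup M] [Module R M] [Module.Finite R M] (rs : List R)
    (reg : IsWeaklyRegular M rs) :
    supportDim R (M ⧸ (Ideal.ofList rs • ⊤ : Submodule R M)) + rs.length ≤ supportDim R M := by
  induction rs generalizing M with
  | nil =>
    rw [Ideal.ofList_nil, Submodule.bot_smul]
    simpa using (supportDim_eq_of_equiv (Submodule.quotEquivOfEqBot ⊥ rfl)).le
  | cons x rs ih =>
    rw [isWeaklyRegular_cons_iff] at reg
    rw [supportDim_eq_of_equiv (Submodule.quotOfListConsSMulTopEquivQuotSMulTopInner M x _),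
      List.length_cons, Nat.cast_succ, ← add_assoc]
    refine (add_le_add_left (ih reg.2) 1).trans ?_
    exact supportDim_quotSMulTop_succ_le_of_notMem_minimalPrimes
      fun _ => reg.1.notMem_of_mem_minimalPrimes

theorem ringKrullDim_quotient_add_length_le_of_isWeaklyRegular {R : Type*} [CommRing R]
    [IsNoetherianRing R] (rs : List R) (reg : IsWeaklyRegular R rs) :
    ringKrullDim (R ⧸ Ideal.ofList rs) + rs.length ≤ ringKrullDim R := by
  have h : Ideal.ofList rs = Ideal.ofList rs • (⊤ : Ideal R) := by simp
  rw [ringKrullDim_eq_of_ringEquiv (Ideal.quotientEquivAlgOfEq R h).toRingEquiv,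
    ← supportDim_quotient_eq_ringKrullDim, ← supportDim_self_eq_ringKrullDim]
  exact supportDim_add_length_le_of_isWeaklyRegular rs reg

namespace MvPolynomial

variable (σ K : Type*) [Field K]

variable {σ} in
/-- The ideal of polynomials vanishing on the coordinate subspace `X i = 0`, `i ∈ s`. -/
def coordIdeal [DecidableEq σ] (s : Finset σ) : Ideal (MvPolynomial σ K) :=
  RingHom.ker (aeval (R := K) fun i => if i ∈ s then (0 : MvPolynomial σ K) else X i)

instance [DecidableEq σ] (s : Finset σ) : (coordIdeal K s).IsPrime :=
  RingHom.ker_isPrime (aeval (R := K) fun i => if i ∈ s then (0 : MvPolynomial σ K) else X i)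

theorem card_le_height_coordIdeal [DecidableEq σ] (s : Finset σ) :
    (s.card : ℕ∞) ≤ (coordIdeal K s).height := by
  induction s using Finset.induction_on with
  | empty => simp
  | insert a s ha ih =>
    rw [Finset.card_insert_of_notMem ha, Nat.cast_succ]
    refine (add_le_add_left ih 1).trans (Ideal.height_add_one_le_of_lt_of_isPrime ?_)
    refine lt_of_le_of_ne (fun p hp => ?_) fun h => ?_
    · have hcomp : (aeval (R := K)
          fun i => if i ∈ insert a s then (0 : MvPolynomial σ K) else X i) =
          (aeval (R := K) fun i => if i = a then (0 : MvPolynomial σ K) else X i).comp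
          (aeval (R := K) fun i => if i ∈ s then (0 : MvPolynomial σ K) else X i) := by
        ext1 i
        by_cases h1 : i = a
        · subst h1
          simp [ha]
        · by_cases h2 : i ∈ s <;> simp [h1, h2]
      rw [coordIdeal, RingHom.mem_ker] at hp ⊢
      rw [hcomp, AlgHom.comp_apply, hp, map_zero]
    · have hX : (X a : MvPolynomial σ K) ∈ coordIdeal K s := by
        rw [h]
        simp [coordIdeal]
      simp [coordIdeal, ha] at hX

/-- The dimension of a complete intersection through the origin. -/
theorem ringKrullDim_quotient_add_length_of_isWeaklyRegular [Finite σ]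
    (l : List (MvPolynomial σ K)) (hl : RingTheory.Sequence.IsWeaklyRegular (MvPolynomial σ K) l)
    (h0 : ∀ p ∈ l, constantCoeff p = 0) :
    ringKrullDim (MvPolynomial σ K ⧸ Ideal.ofList l) + l.length = Nat.card σ := by
  classical
  have := Fintype.ofFinite σ
  have hdim : ringKrullDim (MvPolynomial σ K) = Nat.card σ := by
    rw [ringKrullDim_of_isNoetherianRing, ringKrullDim_eq_zero_of_field, zero_add]
  refine le_antisymm ?_ ?_
  · rw [← hdim]
    exact ringKrullDim_quotient_add_length_le_of_isWeaklyRegular l hl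
  · have hht := card_le_height_coordIdeal σ K Finset.univ
    have hle := Ideal.height_le_ringKrullDim_quotient_add_encard
      (p := coordIdeal K (Finset.univ : Finset σ)) {p | p ∈ l} (by
      intro p hp
      simp only [coordIdeal, SetLike.mem_coe, RingHom.mem_ker, Finset.mem_univ, if_true]
      rw [show (fun _ : σ => (0 : MvPolynomial σ K)) = 0 from rfl, aeval_zero, h0 p hp, map_zero])
    have hcard : {p | p ∈ l}.encard ≤ l.length := by
      rw [← List.coe_toFinset, Set.encard_coe_eq_coe_finsetCard]
      exact_mod_cast l.toFinset_card_le
    rw [Nat.card_eq_fintype_card, ← Finset.card_univ]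
    refine le_trans ?_ (hle.trans ?_)
    · exact_mod_cast hht
    · exact add_le_add le_rfl (by exact_mod_cast hcard)

end MvPolynomial

end Dimension

section OddQuadrics

variable (K : Type*) [Field K] {n m : ℕ}

/-- The weight of the variable in row `r` and column `i`: it makes
`X (j - i, i) * X (n + (j - i), j)` the leading monomial of `x_{i,j}`. -/
def oddWeight (n m : ℕ) (x : Fin (2 * n + 1) × Fin m) : ℕ :=
  if x.1.1 < n then 3 * (n + m) ^ 2 - (2 * x.1.1 * x.2.1 + x.1.1 ^ 2)
  else if x.1.1 < 2 * n then 3 * (n + m) ^ 2 + 2 * (x.1.1 - n) * x.2.1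
  else 0

theorem oddWeight_left {k : ℕ} (hk : k < n) (i : Fin m) (h : k < 2 * n + 1) :
    (oddWeight n m (⟨k, h⟩, i) : ℤ) = 3 * (n + m) ^ 2 - (2 * k * i + k ^ 2) := by
  have hle : 2 * k * i.1 + k ^ 2 ≤ 3 * (n + m) ^ 2 := by
    have := i.2
    nlinarith [Nat.mul_le_mul hk.le this.le, Nat.mul_le_mul hk.le hk.le]
  simp only [oddWeight, hk, if_true]
  rw [Nat.cast_sub hle]
  push_cast
  ring

theorem oddWeight_right {k : ℕ} (hk : k < n) (i : Fin m) (h : n + k < 2 * n + 1) :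
    (oddWeight n m (⟨n + k, h⟩, i) : ℤ) = 3 * (n + m) ^ 2 + 2 * k * i := by
  have h1 : ¬ n + k < n := by omega
  have h2 : n + k < 2 * n := by omega
  simp only [oddWeight, h1, h2, if_true, if_false]
  rw [Nat.add_sub_cancel_left]
  push_cast
  ring

theorem oddWeight_last (i : Fin m) (h : 2 * n < 2 * n + 1) :
    oddWeight n m (⟨2 * n, h⟩, i) = 0 := by
  have h1 : ¬ 2 * n < n := by omega
  simp [oddWeight, h1]

theorem X_mul_X_mem_weightLT {σ : Type*} (w : σ → ℕ) {x y : σ} {k : ℕ} (h : w x + w y < k) :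
    (X x * X y : MvPolynomial σ K) ∈ weightLT K (Finsupp.weight w) k := by
  rw [X, X, monomial_mul]
  exact monomial_mem_weightLT _ (by simpa [Finsupp.weight_single] using h)

theorem hasWeightLead_of_X_mul_X {σ : Type*} (w : σ → ℕ) {x y : σ} {p : MvPolynomial σ K}
    (h : p - X x * X y ∈ weightLT K (Finsupp.weight w) (w x + w y)) :
    HasWeightLead (Finsupp.weight w) p (Finsupp.single x 1 + Finsupp.single y 1) := by
  have hw : Finsupp.weight w (Finsupp.single x 1 + Finsupp.single y 1) = w x + w y := by
    simp [Finsupp.weight_single]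
  rw [HasWeightLead, hw]
  rwa [X, X, monomial_mul, one_mul] at h

theorem oddQuad_hasWeightLead (hmn : m ≤ n) {i j : Fin m} (hij : i ≤ j) :
    HasWeightLead (Finsupp.weight (oddWeight n m)) (oddQuad K n m i j)
      (Finsupp.single (⟨j - i, by omega⟩, i) 1 + Finsupp.single (⟨n + (j - i), by omega⟩, j) 1) := by
  have hij' : i.1 ≤ j.1 := hij
  have hk : j.1 - i.1 < n := by omega
  apply hasWeightLead_of_X_mul_X
  set W := oddWeight n m (⟨j - i, by omega⟩, i) + oddWeight n m (⟨n + (j - i), by omega⟩, j) with hW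
  have hWZ : (W : ℤ) = 6 * (n + m) ^ 2 + ((j : ℤ) - i) ^ 2 := by
    rw [hW, Nat.cast_add, oddWeight_left hk, oddWeight_right hk]
    push_cast [hij']
    ring
  have hc : oddWeight n m (⟨2 * n, by omega⟩, i) + oddWeight n m (⟨2 * n, by omega⟩, j) < W := by
    rw [oddWeight_last, oddWeight_last]
    zify
    rw [hWZ]
    nlinarith [sq_nonneg ((j : ℤ) - i)]
  have ha (k : Fin n) (hki : k ≠ ⟨j - i, hk⟩) :
      oddWeight n m (⟨k.1, by omega⟩, i) + oddWeight n m (⟨n + k.1, by omega⟩, j) < W := by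
    have hne : (k.1 : ℤ) - (j - i) ≠ 0 := by
      intro h
      apply hki
      ext
      simp only
      omega
    zify
    rw [hWZ, oddWeight_left k.2, oddWeight_right k.2]
    nlinarith [pow_pos (abs_pos.2 hne) 2, sq_abs ((k.1 : ℤ) - (j - i))]
  have hb (k : Fin n) (hlt : i < j) :
      oddWeight n m (⟨n + k.1, by omega⟩, i) + oddWeight n m (⟨k.1, by omega⟩, j) < W := by
    have hlt' : (i.1 : ℤ) < j.1 := by exact_mod_cast hlt
    zify
    rw [hWZ, oddWeight_left k.2, oddWeight_right k.2]
    have : (0 : ℤ) ≤ k.1 := by positivity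
    nlinarith [mul_nonneg this (sub_nonneg.2 hlt'.le)]
  have hsum : (∑ k : Fin n, X (⟨k.1, by omega⟩, i) * X (⟨n + k.1, by omega⟩, j)) -
      X (⟨j - i, by omega⟩, i) * X (⟨n + (j - i), by omega⟩, j) ∈
      weightLT K (Finsupp.weight (oddWeight n m)) W := by
    rw [← Finset.add_sum_erase _ _ (Finset.mem_univ ⟨j - i, hk⟩), add_sub_cancel_left]
    exact sum_mem fun k hk' => X_mul_X_mem_weightLT K _ (ha k (Finset.ne_of_mem_erase hk'))
  have hlast : (X (⟨2 * n, by omega⟩, i) * X (⟨2 * n, by omega⟩, j) :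
      MvPolynomial (Fin (2 * n + 1) × Fin m) K) ∈
      weightLT K (Finsupp.weight (oddWeight n m)) W := X_mul_X_mem_weightLT K _ hc
  rcases hij.eq_or_lt with rfl | hlt
  · have := add_mem hsum hlast
    rw [oddQuad, if_pos rfl]
    convert this using 1
    ring
  · have hswap : (∑ k : Fin n, X (⟨n + k.1, by omega⟩, i) * X (⟨k.1, by omega⟩, j) :
        MvPolynomial (Fin (2 * n + 1) × Fin m) K) ∈
        weightLT K (Finsupp.weight (oddWeight n m)) W :=
      sum_mem fun k _ => X_mul_X_mem_weightLT K _ (hb k hlt)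
    have := add_mem (add_mem hsum hswap) (add_mem hlast hlast)
    rw [oddQuad, if_neg hlt.ne, Finset.sum_add_distrib]
    convert this using 1
    ring

theorem constantCoeff_oddQuad (i j : Fin m) : constantCoeff (oddQuad K n m i j) = 0 := by
  unfold oddQuad
  split_ifs <;> simp

/-- The two variables dividing the leading monomial of `x_{i,j}`. -/
def oddLeadVar (hmn : m ≤ n) :
    {p : Fin m × Fin m // p.1 ≤ p.2} ⊕ {p : Fin m × Fin m // p.1 ≤ p.2} →
      Fin (2 * n + 1) × Fin m :=
  Sum.elim (fun p => (⟨p.1.2 - p.1.1, by omega⟩, p.1.1))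
    fun p => (⟨n + (p.1.2 - p.1.1), by omega⟩, p.1.2)

theorem oddLeadVar_injective (hmn : m ≤ n) : Function.Injective (oddLeadVar hmn) := by
  rintro (⟨⟨a, b⟩, h⟩ | ⟨⟨a, b⟩, h⟩) (⟨⟨c, d⟩, h'⟩ | ⟨⟨c, d⟩, h'⟩) heq <;>
    simp only [oddLeadVar, Sum.elim_inl, Sum.elim_inr, Prod.mk.injEq, Fin.ext_iff,
      Sum.inl.injEq, Sum.inr.injEq, Subtype.mk.injEq, Fin.le_def] at heq h h' ⊢ <;> omega

variable (m) in
/-- The pairs `i ≤ j` in lexicographic order. -/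
def oddPairs : List {p : Fin m × Fin m // p.1 ≤ p.2} :=
  ((List.finRange m).flatMap fun i =>
    ((List.finRange m).filter fun j => decide (i ≤ j)).map fun j => (i, j)).attachWith _ (by
      simp only [List.mem_flatMap, List.mem_map, List.mem_filter, decide_eq_true_eq]
      rintro _ ⟨i, -, j, ⟨-, h⟩, rfl⟩
      exact h)

theorem map_val_oddPairs : (oddPairs m).map Subtype.val =
    (List.finRange m).flatMap fun i =>
      ((List.finRange m).filter fun j => decide (i ≤ j)).map fun j => (i, j) := by
  rw [oddPairs, List.attachWith_map_subtype_val]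

theorem map_oddPairs : (oddPairs m).map (fun p => oddQuad K n m p.1.1 p.1.2) = oddList K n m := by
  have : (oddPairs m).map (fun p => oddQuad K n m p.1.1 p.1.2) =
      ((oddPairs m).map Subtype.val).map fun p => oddQuad K n m p.1 p.2 := by
    rw [List.map_map]
    rfl
  rw [this, map_val_oddPairs, List.map_flatMap, oddList]
  simp [Function.comp_def]

theorem nodup_oddPairs : (oddPairs m).Nodup := by
  refine List.Nodup.of_map Subtype.val ?_
  rw [map_val_oddPairs, List.nodup_flatMap]
  refine ⟨fun i _ => ((List.nodup_finRange m).filter _).map (Prod.mk_right_injective i), ?_⟩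
  refine (List.nodup_finRange m).imp fun {a b} hab => ?_
  simp only [Function.onFun, List.Disjoint, List.mem_map]
  rintro _ ⟨_, -, rfl⟩ ⟨_, -, h⟩
  exact hab (Prod.ext_iff.1 h).1.symm

theorem mem_oddPairs (p : {p : Fin m × Fin m // p.1 ≤ p.2}) : p ∈ oddPairs m := by
  obtain ⟨⟨i, j⟩, h⟩ := p
  have h : i ≤ j := h
  simp [oddPairs, h]

theorem length_oddPairs : (oddPairs m).length = m * (m + 1) / 2 := by
  rw [← List.toFinset_card_of_nodup nodup_oddPairs,
    show (oddPairs m).toFinset = Finset.univ by ext p; simp [mem_oddPairs], Finset.card_univ,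
    ← Fintype.card_congr Sym2.sortEquiv, Sym2.card, Fintype.card_fin, Nat.choose_two_right,
    Nat.add_sub_cancel, mul_comm]

end OddQuadrics

/-- The `m(m+1)/2` odd orthogonal quadrics `x_{i,j}` (`i ≤ j`) form a regular sequence in
`K[X_{k,i}]`, and the quotient by the ideal they generate (a complete intersection) has
Krull dimension `(2n+1)m − m(m+1)/2`. -/
theorem statement2 (K : Type*) [Field K] (m n : ℕ) (hm : 1 ≤ m) (hmn : m ≤ n) :
    RingTheory.Sequence.IsRegular (MvPolynomial (Fin (2 * n + 1) × Fin m) K)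
        (oddList K n m) ∧
      ringKrullDim ((MvPolynomial (Fin (2 * n + 1) × Fin m) K) ⧸
          Ideal.span {p : MvPolynomial (Fin (2 * n + 1) × Fin m) K |
            ∃ i j : Fin m, i ≤ j ∧ p = oddQuad K n m i j}) =
        ((2 * n + 1) * m - m * (m + 1) / 2 : ℕ) := by
  have hreg : RingTheory.Sequence.IsWeaklyRegular (MvPolynomial (Fin (2 * n + 1) × Fin m) K)
      (oddList K n m) := by
    rw [← map_oddPairs]
    exact isWeaklyRegular_of_hasWeightLead _ (oddLeadVar hmn) (oddLeadVar_injective hmn) _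
      (fun p => oddQuad_hasWeightLead K hmn p.2) _ nodup_oddPairs
  have h0 : ∀ p ∈ oddList K n m, constantCoeff p = 0 := by
    rw [← map_oddPairs]
    simp only [List.mem_map]
    rintro _ ⟨p, -, rfl⟩
    exact constantCoeff_oddQuad K _ _
  have hspan : Ideal.span {p : MvPolynomial (Fin (2 * n + 1) × Fin m) K |
      ∃ i j : Fin m, i ≤ j ∧ p = oddQuad K n m i j} = Ideal.ofList (oddList K n m) := by
    rw [Ideal.ofList]
    congr 1
    ext p
    rw [← map_oddPairs]
    simp [mem_oddPairs, eq_comm]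
  refine ⟨⟨hreg, fun htop => ?_⟩, ?_⟩
  · have hle : Ideal.ofList (oddList K n m) ≤ RingHom.ker (constantCoeff (R := K)) :=
      Ideal.span_le.2 h0
    have h1 : (1 : MvPolynomial (Fin (2 * n + 1) × Fin m) K) ∈ Ideal.ofList (oddList K n m) := by
      rw [smul_eq_mul, Ideal.mul_top] at htop
      rw [← htop]
      trivial
    simpa using hle h1
  · have hdim := ringKrullDim_quotient_add_length_of_isWeaklyRegular _ K _ hreg h0
    rw [← hspan, ← map_oddPairs, List.length_map, length_oddPairs, Nat.card_prod, Nat.card_fin,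
      Nat.card_fin] at hdim
    exact WithBot.eq_natCast_sub_of_add_natCast_eq hdim
end
end

section
/- Let K be a field and let m, n be integers with 1 ≤ m ≤ n. In the polynomial ring R = K[X_{k,i} : 1 ≤ k ≤ 2n, 1 ≤ i ≤ m], the m(m+1)/2 quadratic polynomials x_{i,j} for 1 ≤ i ≤ j ≤ m, where x_{i,i} = Σ_{k=1}^{n} X_{k,i}X_{n+k,i} and, for i < j, x_{i,j} = Σ_{k=1}^{n} (X_{k,i} X_{n+k,j} + X_{n+k,i} X_{k,j}), form a regular sequence; in particular R/(x_{i,j} : i ≤ j) is a complete intersection ring of Krull dimension 2nm − m(m+1)/2. -/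
noncomputable section

open MvPolynomial

/-- The even orthogonal quadric `x_{i,j}` for `i ≤ j`:
`x_{i,i} = ∑_{k=1}^{n} X_{k,i}X_{n+k,i}` and, for `i < j`,
`x_{i,j} = ∑_{k=1}^{n} (X_{k,i} X_{n+k,j} + X_{n+k,i} X_{k,j})`. -/
def evenQuad (K : Type*) [Field K] (n m : ℕ) (i j : Fin m) :
    MvPolynomial (Fin (2 * n) × Fin m) K :=
  if i = j then
    ∑ k : Fin n,
      X (⟨k.1, by have := k.2; omega⟩, i) * X (⟨n + k.1, by have := k.2; omega⟩, i)
  else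
    ∑ k : Fin n,
      (X (⟨k.1, by have := k.2; omega⟩, i) * X (⟨n + k.1, by have := k.2; omega⟩, j)
        + X (⟨n + k.1, by have := k.2; omega⟩, i) * X (⟨k.1, by have := k.2; omega⟩, j))

/-- The list of the quadrics `x_{i,j}` for `i ≤ j`, in lexicographic order. -/
def evenList (K : Type*) [Field K] (n m : ℕ) :
    List (MvPolynomial (Fin (2 * n) × Fin m) K) :=
  (List.finRange m).flatMap fun i =>
    ((List.finRange m).filter fun j => decide (i ≤ j)).map fun j => evenQuad K n m i j

/-- The polynomials all of whose monomials have weight smaller than `D`. -/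
def belowWeight (K : Type*) [Field K] {σ : Type*} (w : σ → ℕ) (D : ℕ) :
    Submodule K (MvPolynomial σ K) :=
  restrictSupport K {d | Finsupp.weight w d < D}

/-- `X ^ s` is the initial form of `f` with respect to the weight `w`. -/
def IsInitialMonomial {K : Type*} [Field K] {σ : Type*} (w : σ → ℕ) (f : MvPolynomial σ K)
    (s : σ →₀ ℕ) : Prop :=
  f - monomial s 1 ∈ belowWeight K w (Finsupp.weight w s)

section InitialMonomial

variable {K : Type*} [Field K] {σ : Type*} {w : σ → ℕ}

lemma mem_belowWeight {D : ℕ} {p : MvPolynomial σ K} :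
    p ∈ belowWeight K w D ↔ ∀ d, coeff d p ≠ 0 → Finsupp.weight w d < D := by
  simp [belowWeight, mem_restrictSupport_iff, Set.subset_def]

lemma belowWeight_mono {D E : ℕ} (h : D ≤ E) : belowWeight K w D ≤ belowWeight K w E :=
  fun _ hp => mem_belowWeight.2 fun d hd => (mem_belowWeight.1 hp d hd).trans_le h

lemma exists_mem_belowWeight (p : MvPolynomial σ K) : ∃ D, p ∈ belowWeight K w D := by
  refine ⟨p.support.sup (Finsupp.weight w) + 1, mem_belowWeight.2 fun d hd => ?_⟩
  exact Nat.lt_succ_of_le (Finset.le_sup (f := Finsupp.weight w) (mem_support_iff.2 hd))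

lemma monomial_mem_belowWeight {D : ℕ} {d : σ →₀ ℕ} (c : K) (h : Finsupp.weight w d < D) :
    monomial d c ∈ belowWeight K w D := by
  classical
  refine mem_belowWeight.2 fun e he => ?_
  rw [coeff_monomial] at he
  split_ifs at he with hde
  · exact hde ▸ h
  · exact absurd rfl he

lemma mul_mem_belowWeight {D E : ℕ} {p q : MvPolynomial σ K} (hp : p ∈ belowWeight K w (D + 1))
    (hq : q ∈ belowWeight K w E) : p * q ∈ belowWeight K w (D + E) := by
  classical
  refine mem_belowWeight.2 fun e he => ?_
  rw [coeff_mul] at he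
  obtain ⟨⟨a, b⟩, hab, hne⟩ := Finset.exists_ne_zero_of_sum_ne_zero he
  have ha := mem_belowWeight.1 hp a (left_ne_zero_of_mul hne)
  have hb := mem_belowWeight.1 hq b (right_ne_zero_of_mul hne)
  obtain rfl : a + b = e := Finset.HasAntidiagonal.mem_antidiagonal.1 hab
  rw [map_add]
  omega

namespace IsInitialMonomial

variable {f : MvPolynomial σ K} {s : σ →₀ ℕ}

lemma mem_belowWeight (h : IsInitialMonomial w f s) :
    f ∈ belowWeight K w (Finsupp.weight w s + 1) := by
  have := add_mem (belowWeight_mono (Nat.le_succ _) h)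
    (monomial_mem_belowWeight (1 : K) (Nat.lt_succ_self (Finsupp.weight w s)))
  simpa using this

lemma coeff_mul_eq (h : IsInitialMonomial w f s) {a : MvPolynomial σ K} {D : ℕ}
    (ha : a ∈ belowWeight K w (D + 1)) {e : σ →₀ ℕ}
    (he : D + Finsupp.weight w s ≤ Finsupp.weight w e) :
    coeff e (a * f) = coeff e (a * monomial s 1) := by
  have hlow : coeff e (a * (f - monomial s 1)) = 0 := by
    by_contra hne
    exact absurd (_root_.mem_belowWeight.1 (mul_mem_belowWeight ha h) e hne) (not_lt.2 he)
  rwa [mul_sub, coeff_sub, sub_eq_zero] at hlow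

lemma coeff_add_mul (h : IsInitialMonomial w f s) {a : MvPolynomial σ K} {D : ℕ}
    (ha : a ∈ belowWeight K w (D + 1)) {d : σ →₀ ℕ} (hd : Finsupp.weight w d = D) :
    coeff (d + s) (a * f) = coeff d a := by
  rw [h.coeff_mul_eq ha (by rw [map_add, hd]), coeff_mul_monomial, mul_one]

end IsInitialMonomial

variable {ι : Type*} {f : ι → MvPolynomial σ K} {s : ι → σ →₀ ℕ}

/-- The initial monomials of the members of the ideal generated by `f t`, `t ∈ l`, are divisible
by one of the monomials `X ^ s t`, `t ∈ l`. -/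
def GeneratesInitialIdeal (w : σ → ℕ) (f : ι → MvPolynomial σ K) (s : ι → σ →₀ ℕ)
    (l : List ι) : Prop :=
  ∀ D, ∀ g ∈ Ideal.ofList (l.map f), g ∈ belowWeight K w (D + 1) →
    ∀ d, coeff d g ≠ 0 → Finsupp.weight w d = D → ∃ t ∈ l, s t ≤ d

lemma exists_mem_ofList_sub_mem_belowWeight (hf : ∀ t, IsInitialMonomial w (f t) (s t))
    {l : List ι} {D : ℕ} {a : MvPolynomial σ K} (ha : a ∈ belowWeight K w (D + 1))
    (hdiv : ∀ d, coeff d a ≠ 0 → Finsupp.weight w d = D → ∃ t ∈ l, s t ≤ d) :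
    ∃ h ∈ Ideal.ofList (l.map f), a - h ∈ belowWeight K w D := by
  have key : ∀ d : σ →₀ ℕ, ∃ h ∈ Ideal.ofList (l.map f),
      monomial d (coeff d a) - h ∈ belowWeight K w D := by
    intro d
    by_cases hd : coeff d a = 0
    · exact ⟨0, zero_mem _, by simp [hd]⟩
    rcases (Nat.lt_succ_iff.1 (mem_belowWeight.1 ha d hd)).lt_or_eq with hlt | heq
    · exact ⟨0, zero_mem _, by simpa using monomial_mem_belowWeight _ hlt⟩
    · obtain ⟨t, htl, htd⟩ := hdiv d hd heq
      refine ⟨monomial (d - s t) (coeff d a) * f t, Ideal.mul_mem_left _ _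
        (Ideal.subset_span (List.mem_map_of_mem htl)), ?_⟩
      have hsplit : monomial d (coeff d a) =
          monomial (d - s t) (coeff d a) * monomial (s t) 1 := by
        rw [monomial_mul, mul_one, tsub_add_cancel_of_le htd]
      rw [hsplit, ← mul_sub, ← neg_sub (f t), mul_neg]
      have := mul_mem_belowWeight (monomial_mem_belowWeight (coeff d a)
        (Nat.lt_succ_self (Finsupp.weight w (d - s t)))) (hf t)
      rw [← map_add, tsub_add_cancel_of_le htd, heq] at this
      exact neg_mem this
  choose h hI hlow using key
  refine ⟨∑ d ∈ a.support, h d, sum_mem fun d _ => hI d, ?_⟩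
  have hsum : a - ∑ d ∈ a.support, h d
      = ∑ d ∈ a.support, (monomial d (coeff d a) - h d) := by
    rw [Finset.sum_sub_distrib, support_sum_monomial_coeff]
  rw [hsum]
  exact sum_mem fun d _ => hlow d

namespace GeneratesInitialIdeal

lemma nil : GeneratesInitialIdeal w f s [] := by
  intro D g hg _ d hd
  simp only [List.map_nil, Ideal.ofList_nil, Ideal.mem_bot] at hg
  simp [hg] at hd

lemma mem_of_mul_mem (hf : ∀ t, IsInitialMonomial w (f t) (s t)) {l : List ι}
    (hl : GeneratesInitialIdeal w f s l) {r : ι} (hr : ∀ t ∈ l, ∀ v, s t v = 0 ∨ s r v = 0)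
    {a : MvPolynomial σ K} (ha : a * f r ∈ Ideal.ofList (l.map f)) :
    a ∈ Ideal.ofList (l.map f) := by
  obtain ⟨D, hD⟩ := exists_mem_belowWeight (w := w) a
  induction D generalizing a with
  | zero =>
    have : a = 0 := by
      ext d
      by_contra hne
      exact absurd (mem_belowWeight.1 hD d hne) (Nat.not_lt_zero _)
    simp [this]
  | succ D ih =>
    obtain ⟨h, hI, hlow⟩ := exists_mem_ofList_sub_mem_belowWeight (l := l) hf hD fun d hd hdD => by
      obtain ⟨t, ht, hle⟩ := hl (D + Finsupp.weight w (s r)) (a * f r) ha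
        (by simpa [add_assoc] using mul_mem_belowWeight hD (hf r).mem_belowWeight) (d + s r)
        (by rwa [(hf r).coeff_add_mul hD hdD]) (by rw [map_add, hdD])
      refine ⟨t, ht, fun v => ?_⟩
      have := hle v
      rcases hr t ht v with h0 | h0 <;> simp_all
    have := ih (a := a - h) (by rw [sub_mul]; exact sub_mem ha (Ideal.mul_mem_right _ _ hI)) hlow
    simpa using add_mem this hI

lemma concat (hf : ∀ t, IsInitialMonomial w (f t) (s t)) {l : List ι}
    (hl : GeneratesInitialIdeal w f s l) {r : ι} (hr : ∀ t ∈ l, ∀ v, s t v = 0 ∨ s r v = 0) :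
    GeneratesInitialIdeal w f s (l ++ [r]) := by
  intro D g hg hgD d hd hdD
  have hrep : ∃ b ∈ Ideal.ofList (l.map f), ∃ a, b + a * f r = g := by
    rw [List.map_append, Ideal.ofList_append, List.map_singleton, Ideal.ofList_singleton,
      Submodule.mem_sup] at hg
    obtain ⟨b, hb, c, hc, hbc⟩ := hg
    obtain ⟨a, rfl⟩ := Ideal.mem_span_singleton'.1 hc
    exact ⟨b, hb, a, hbc⟩
  obtain ⟨b, hb, a, hab⟩ := hrep
  obtain ⟨E, hE⟩ := exists_mem_belowWeight (w := w) a
  induction E generalizing a b with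
  | zero =>
    have : a = 0 := by
      ext d
      by_contra hne
      exact absurd (mem_belowWeight.1 hE d hne) (Nat.not_lt_zero _)
    obtain ⟨t, ht, hle⟩ := hl D g (by rwa [← hab, this, zero_mul, add_zero]) hgD d hd hdD
    exact ⟨t, List.mem_append_left _ ht, hle⟩
  | succ E ih =>
    have haf : a * f r ∈ belowWeight K w (E + Finsupp.weight w (s r) + 1) := by
      simpa [add_assoc] using mul_mem_belowWeight hE (hf r).mem_belowWeight
    by_cases hED : E + Finsupp.weight w (s r) ≤ D
    · have haf' := belowWeight_mono (Nat.succ_le_succ hED) haf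
      have hbD : b ∈ belowWeight K w (D + 1) := by
        simpa [← hab] using sub_mem hgD haf'
      by_cases hbd : coeff d b = 0
      · refine ⟨r, by simp, ?_⟩
        have hne : coeff d (a * f r) ≠ 0 := by
          rw [← hab, coeff_add, hbd, zero_add] at hd
          exact hd
        rw [(hf r).coeff_mul_eq hE (hdD ▸ hED), coeff_mul_monomial'] at hne
        by_contra hle
        exact hne (if_neg hle)
      · obtain ⟨t, ht, hle⟩ := hl D b hb hbD d hbd hdD
        exact ⟨t, List.mem_append_left _ ht, hle⟩
    · push Not at hED
      have hg' : g ∈ belowWeight K w (E + Finsupp.weight w (s r)) := belowWeight_mono hED hgD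
      have hbE : b ∈ belowWeight K w (E + Finsupp.weight w (s r) + 1) := by
        simpa [← hab] using sub_mem (belowWeight_mono (Nat.le_succ _) hg') haf
      obtain ⟨h, hI, hlow⟩ := exists_mem_ofList_sub_mem_belowWeight (l := l) hf hE
        fun e he heE => by
          have hge : coeff (e + s r) g = 0 := by
            by_contra hne
            have := mem_belowWeight.1 hg' _ hne
            rw [map_add, heE] at this
            exact lt_irrefl _ this
          rw [← hab, coeff_add, (hf r).coeff_add_mul hE heE] at hge
          obtain ⟨t, ht, hle⟩ := hl _ b hb hbE (e + s r)
            (fun h0 => he (by simpa [h0] using hge)) (by rw [map_add, heE])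
          refine ⟨t, ht, fun v => ?_⟩
          have := hle v
          rcases hr t ht v with h0 | h0 <;> simp_all
      exact ih (b + h * f r) (add_mem hb (Ideal.mul_mem_right _ _ hI)) (a - h)
        (by rw [← hab]; ring) hlow

lemma of_pairwise (hf : ∀ t, IsInitialMonomial w (f t) (s t)) {l : List ι}
    (hl : l.Pairwise fun t r => ∀ v, s t v = 0 ∨ s r v = 0) : GeneratesInitialIdeal w f s l := by
  induction l using List.reverseRecOn with
  | nil => exact nil
  | append_singleton l r ih =>
    rw [List.pairwise_append] at hl
    exact (ih hl.1).concat hf fun t ht => hl.2.2 t ht r (by simp)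

end GeneratesInitialIdeal

/-- Polynomials with pairwise coprime initial monomials form a weakly regular sequence. -/
theorem isWeaklyRegular_of_isInitialMonomial (hf : ∀ t, IsInitialMonomial w (f t) (s t))
    {l : List ι} (hl : l.Pairwise fun t r => ∀ v, s t v = 0 ∨ s r v = 0) :
    RingTheory.Sequence.IsWeaklyRegular (MvPolynomial σ K) (l.map f) := by
  induction l using List.reverseRecOn with
  | nil => exact .nil _ _
  | append_singleton l r ih =>
    rw [List.pairwise_append] at hl
    rw [List.map_append, RingTheory.Sequence.isWeaklyRegular_append_iff]
    refine ⟨ih hl.1, ?_⟩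
    rw [List.map_singleton, RingTheory.Sequence.isWeaklyRegular_singleton_iff,
      isSMulRegular_quotient_iff_mem_of_smul_mem]
    intro a ha
    simp only [smul_eq_mul, Ideal.mul_top] at ha ⊢
    rw [mul_comm] at ha
    exact (GeneratesInitialIdeal.of_pairwise hf hl.1).mem_of_mul_mem hf
      (fun t ht => hl.2.2 t ht r (by simp)) ha

end InitialMonomial

/-- Dividing by a weakly regular sequence lowers the Krull dimension by at least its length. -/
theorem ringKrullDim_quotient_ofList_add_length_le {R : Type*} [CommRing R] {rs : List R}
    (h : RingTheory.Sequence.IsWeaklyRegular R rs) :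
    ringKrullDim (R ⧸ Ideal.ofList rs) + rs.length ≤ ringKrullDim R := by
  induction rs using List.reverseRecOn with
  | nil =>
    simpa using ringKrullDim_le_of_surjective _ (Ideal.Quotient.mk_surjective (I := Ideal.ofList []))
  | append_singleton l r ih =>
    rw [RingTheory.Sequence.isWeaklyRegular_append_iff,
      RingTheory.Sequence.isWeaklyRegular_singleton_iff,
      isSMulRegular_quotient_iff_mem_of_smul_mem] at h
    refine le_trans ?_ (ih h.1)
    have hle : Ideal.ofList l ≤ Ideal.ofList (l ++ [r]) := by simp
    have hreg : Ideal.Quotient.mk (Ideal.ofList l) r ∈ nonZeroDivisors (R ⧸ Ideal.ofList l) := by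
      rw [mem_nonZeroDivisors_iff_right]
      intro x hx
      obtain ⟨a, rfl⟩ := Ideal.Quotient.mk_surjective x
      rw [← map_mul, Ideal.Quotient.eq_zero_iff_mem] at hx
      rw [Ideal.Quotient.eq_zero_iff_mem]
      simpa using h.2 a (by simpa [mul_comm] using hx)
    have := ringKrullDim_succ_le_of_surjective (Ideal.Quotient.factor hle)
      (Ideal.Quotient.factor_surjective hle) hreg (by
        rw [Ideal.Quotient.factor_mk, Ideal.Quotient.eq_zero_iff_mem]
        exact Ideal.subset_span (by simp))
    simp only [List.length_append, List.length_singleton, Nat.cast_add, Nat.cast_one]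
    rw [add_comm (l.length : WithBot ℕ∞), ← add_assoc]
    gcongr

/-- The ideal of the origin has height at least the number of variables. -/
theorem card_le_height_ker_aeval_zero (K : Type*) [Field K] (σ : Type*) [Fintype σ] :
    (Fintype.card σ : ℕ∞) ≤ (RingHom.ker (aeval (fun _ => 0) : MvPolynomial σ K →ₐ[K] K)).height := by
  classical
  let e := Fintype.equivFin σ
  let φ (t : ℕ) : MvPolynomial σ K →ₐ[K] MvPolynomial σ K :=
    aeval fun i => if (e i : ℕ) < t then 0 else X i
  have hprime (t : ℕ) : (RingHom.ker (φ t)).IsPrime := RingHom.ker_isPrime _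
  have hcomp (t : ℕ) : (φ (t + 1)).comp (φ t) = φ (t + 1) := by
    ext1 i
    simp only [φ, AlgHom.comp_apply, aeval_X]
    by_cases h : (e i : ℕ) < t
    · simp [h, Nat.lt_succ_of_lt h]
    · simp [h]
  have hmono (t : ℕ) : RingHom.ker (φ t) ≤ RingHom.ker (φ (t + 1)) := fun p hp => by
    rw [RingHom.mem_ker] at hp ⊢
    rw [← hcomp t, AlgHom.comp_apply, hp, map_zero]
  have hheight (t : ℕ) (ht : t ≤ Fintype.card σ) : (t : ℕ∞) ≤ (RingHom.ker (φ t)).height := by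
    induction t with
    | zero => simp
    | succ t ih =>
      have hlt : RingHom.ker (φ t) < RingHom.ker (φ (t + 1)) := by
        refine lt_of_le_not_ge (hmono t) fun hle => ?_
        have hmem : (X (e.symm ⟨t, ht⟩) : MvPolynomial σ K) ∈ RingHom.ker (φ (t + 1)) := by
          simp [RingHom.mem_ker, φ]
        have := hle hmem
        simp [RingHom.mem_ker, φ] at this
      push_cast
      exact (add_le_add_left (ih (by omega)) 1).trans
        (Ideal.height_add_one_le_of_lt_of_isPrime hlt)
  refine (hheight _ le_rfl).trans (Ideal.height_mono fun p hp => ?_)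
  rw [RingHom.mem_ker] at hp ⊢
  have hzero : (aeval (fun _ => 0) : MvPolynomial σ K →ₐ[K] K).comp (φ (Fintype.card σ)) =
      aeval (fun _ => 0) := by
    ext1 i
    simp [φ]
  rw [← hzero, AlgHom.comp_apply, hp, map_zero]
section EvenQuad

/-- A weight for which the initial form of `evenQuad K n m i j` is the product of the entries
`(j - i, i)` and `(n + (j - i), j)`. -/
def evenWeight (n m : ℕ) (v : Fin (2 * n) × Fin m) : ℕ :=
  if v.1.1 < n then 2 * n * m + n * n - 2 * v.1.1 * v.2.1
  else 2 * n * m + n * n + 2 * (v.1.1 - n) * v.2.1 - (v.1.1 - n) * (v.1.1 - n)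

lemma evenWeight_fst {n m : ℕ} {a : Fin (2 * n)} {k : ℕ} (hk : k < n) (i : Fin m)
    (ha : a.1 = k) : (evenWeight n m (a, i) : ℤ) = 2 * n * m + n * n - 2 * k * i := by
  have h : 2 * k * i.1 ≤ 2 * n * m + n * n := by
    have := Nat.mul_le_mul hk.le i.2.le
    nlinarith
  simp only [evenWeight, ha, if_pos hk]
  push_cast [Nat.cast_sub h]
  ring

lemma evenWeight_snd {n m : ℕ} {a : Fin (2 * n)} {k : ℕ} (hk : k < n) (i : Fin m)
    (ha : a.1 = n + k) :
    (evenWeight n m (a, i) : ℤ) = 2 * n * m + n * n + 2 * k * i - k * k := by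
  have h : k * k ≤ 2 * n * m + n * n + 2 * k * i.1 := by
    have := Nat.mul_le_mul hk.le hk.le
    nlinarith
  simp only [evenWeight, ha, if_neg (Nat.not_lt.2 (Nat.le_add_right n k)), Nat.add_sub_cancel_left]
  push_cast [Nat.cast_sub h]
  ring

/-- The exponent of the initial monomial of `evenQuad K n m i j`. -/
def evenExponent {n m : ℕ} (hmn : m ≤ n) (i j : Fin m) : Fin (2 * n) × Fin m →₀ ℕ :=
  Finsupp.single (⟨j.1 - i.1, by omega⟩, i) 1 +
    Finsupp.single (⟨n + (j.1 - i.1), by omega⟩, j) 1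

lemma weight_evenExponent {n m : ℕ} (hmn : m ≤ n) {i j : Fin m} (hij : i ≤ j) :
    (Finsupp.weight (evenWeight n m) (evenExponent hmn i j) : ℤ) =
      2 * (2 * n * m + n * n) + (j - i) * (j - i) := by
  have hk : j.1 - i.1 < n := by omega
  rw [evenExponent, map_add, Finsupp.weight_single, Finsupp.weight_single]
  push_cast [smul_eq_mul]
  rw [evenWeight_fst hk i rfl, evenWeight_snd hk j rfl, Nat.cast_sub hij]
  ring

lemma X_mul_X_mem_belowWeight (K : Type*) [Field K] {n m : ℕ} {a b : Fin (2 * n)} {i j : Fin m}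
    {k D : ℕ} (hk : k < n) (ha : a.1 = k) (hb : b.1 = n + k)
    (h : 2 * (2 * n * m + n * n) + 2 * k * (j - i : ℤ) - k * k < D) :
    (X (a, i) * X (b, j) : MvPolynomial (Fin (2 * n) × Fin m) K) ∈
      belowWeight K (evenWeight n m) D := by
  rw [X, X, monomial_mul]
  refine monomial_mem_belowWeight _ ?_
  rw [map_add, Finsupp.weight_single, Finsupp.weight_single]
  zify
  simp only [smul_eq_mul, one_mul]
  rw [evenWeight_fst hk i ha, evenWeight_snd hk j hb]
  linarith

lemma isInitialMonomial_evenQuad (K : Type*) [Field K] {n m : ℕ} (hmn : m ≤ n) {i j : Fin m}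
    (hij : i ≤ j) :
    IsInitialMonomial (evenWeight n m) (evenQuad K n m i j) (evenExponent hmn i j) := by
  have hk : j.1 - i.1 < n := by omega
  have hw := weight_evenExponent hmn hij
  have hsub : ((j.1 - i.1 : ℕ) : ℤ) = j - i := Nat.cast_sub hij
  have hmain : ∑ k : Fin n, X (⟨k.1, by omega⟩, i) * X (⟨n + k.1, by omega⟩, j) -
      monomial (evenExponent hmn i j) (1 : K) ∈
        belowWeight K (evenWeight n m) (Finsupp.weight (evenWeight n m) (evenExponent hmn i j)) := by
    have hlead : monomial (evenExponent hmn i j) (1 : K) =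
        X (⟨j.1 - i.1, by omega⟩, i) * X (⟨n + (j.1 - i.1), by omega⟩, j) := by
      rw [X, X, monomial_mul, mul_one, evenExponent]
    rw [hlead, ← Finset.add_sum_erase _ _ (Finset.mem_univ (⟨j.1 - i.1, hk⟩ : Fin n)),
      add_sub_cancel_left]
    refine sum_mem fun k hkmem => X_mul_X_mem_belowWeight K k.2 rfl rfl ?_
    have hne : (k.1 : ℤ) - (j - i) ≠ 0 := by
      rw [← hsub, sub_ne_zero]
      exact_mod_cast fun h => Finset.ne_of_mem_erase hkmem (Fin.ext h)
    rw [hw]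
    nlinarith [sq_pos_of_ne_zero hne]
  rw [IsInitialMonomial, evenQuad]
  split_ifs with h
  · subst h
    exact hmain
  · rw [Finset.sum_add_distrib, add_sub_right_comm]
    refine add_mem hmain (sum_mem fun k _ => ?_)
    rw [mul_comm (X _)]
    refine X_mul_X_mem_belowWeight K k.2 rfl rfl ?_
    have hlt : (0 : ℤ) < j - i := by
      have : i.1 < j.1 := lt_of_le_of_ne hij fun h' => h (Fin.ext h')
      omega
    rw [hw]
    nlinarith [mul_nonneg (Int.natCast_nonneg k.1) hlt.le, mul_pos hlt hlt, sq_nonneg (k.1 : ℤ)]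

lemma evenExponent_coprime {n m : ℕ} (hmn : m ≤ n) {i j i' j' : Fin m} (hij : i ≤ j)
    (hij' : i' ≤ j') (hne : (i, j) ≠ (i', j')) (v : Fin (2 * n) × Fin m) :
    evenExponent hmn i j v = 0 ∨ evenExponent hmn i' j' v = 0 := by
  classical
  obtain ⟨a, c⟩ := v
  simp only [evenExponent, Finsupp.add_apply, Finsupp.single_apply, Prod.mk.injEq, Fin.ext_iff,
    ne_eq] at hne ⊢
  rw [Fin.le_def] at hij hij'
  split_ifs <;> omega

/-- The pairs `(i, j)` with `i ≤ j`, in lexicographic order. -/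
def upperPairs (m : ℕ) : List (Fin m × Fin m) :=
  (List.finRange m).flatMap fun i =>
    ((List.finRange m).filter fun j => decide (i ≤ j)).map fun j => (i, j)

lemma mem_upperPairs {m : ℕ} {p : Fin m × Fin m} : p ∈ upperPairs m ↔ p.1 ≤ p.2 := by
  obtain ⟨i, j⟩ := p
  simp [upperPairs]

lemma nodup_upperPairs (m : ℕ) : (upperPairs m).Nodup := by
  refine List.nodup_flatMap.2 ⟨fun i _ => ?_, ?_⟩
  · exact ((List.nodup_finRange m).filter _).map fun _ _ h => (Prod.mk.inj h).2
  · refine (List.nodup_finRange m).imp fun {i i'} hne => ?_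
    intro p hp hp'
    simp only [List.mem_map] at hp hp'
    obtain ⟨_, _, rfl⟩ := hp
    obtain ⟨_, _, h⟩ := hp'
    exact hne (Prod.mk.inj h).1.symm

lemma length_upperPairs (m : ℕ) : (upperPairs m).length = m * (m + 1) / 2 := by
  have hfin : (upperPairs m).toFinset =
      ((Finset.univ : Finset (Fin m)).sigma fun j => Finset.Iic j).map
        ⟨fun x => (x.2, x.1), by rintro ⟨a, b⟩ ⟨c, d⟩ h; simp_all⟩ := by
    ext ⟨i, j⟩
    simp only [List.mem_toFinset, mem_upperPairs, Finset.mem_map, Finset.mem_sigma,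
      Finset.mem_univ, Finset.mem_Iic, true_and]
    exact ⟨fun h => ⟨⟨j, i⟩, h, rfl⟩, by rintro ⟨_, h, ⟨⟩⟩; exact h⟩
  rw [← List.toFinset_card_of_nodup (nodup_upperPairs m), hfin, Finset.card_map,
    Finset.card_sigma]
  simp only [Fin.card_Iic]
  rw [Fin.sum_univ_eq_sum_range (fun k => k + 1), Finset.sum_add_distrib, Finset.sum_const,
    Finset.card_range, smul_eq_mul, mul_one, ← Finset.sum_range_succ, Finset.sum_range_id,
    Nat.add_sub_cancel, mul_comm]

lemma evenList_eq_map_upperPairs (K : Type*) [Field K] (n m : ℕ) :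
    evenList K n m = (upperPairs m).map fun p => evenQuad K n m p.1 p.2 := by
  simp [evenList, upperPairs, List.map_flatMap, Function.comp_def]

lemma evenQuad_mem_ker_aeval_zero (K : Type*) [Field K] (n m : ℕ) (i j : Fin m) :
    evenQuad K n m i j ∈
      RingHom.ker (aeval (fun _ => 0) : MvPolynomial (Fin (2 * n) × Fin m) K →ₐ[K] K) := by
  rw [RingHom.mem_ker, evenQuad]
  split_ifs <;> simp

lemma isWeaklyRegular_evenList (K : Type*) [Field K] {n m : ℕ} (hmn : m ≤ n) :
    RingTheory.Sequence.IsWeaklyRegular (MvPolynomial (Fin (2 * n) × Fin m) K)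
      (evenList K n m) := by
  have h := isWeaklyRegular_of_isInitialMonomial (w := evenWeight n m)
    (f := fun p : {p // p ∈ upperPairs m} => evenQuad K n m p.1.1 p.1.2)
    (s := fun p => evenExponent hmn p.1.1 p.1.2)
    (fun p => isInitialMonomial_evenQuad K hmn (mem_upperPairs.1 p.2))
    (l := (upperPairs m).attach)
    ((List.nodup_attach.2 (nodup_upperPairs m)).imp fun {p q} hpq =>
      evenExponent_coprime hmn (mem_upperPairs.1 p.2) (mem_upperPairs.1 q.2)
        fun h => hpq (Subtype.ext h))
  rwa [List.attach_map_val (f := fun p : Fin m × Fin m => evenQuad K n m p.1 p.2),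
    ← evenList_eq_map_upperPairs] at h

lemma ofList_evenList (K : Type*) [Field K] (n m : ℕ) :
    Ideal.ofList (evenList K n m) = Ideal.span {p : MvPolynomial (Fin (2 * n) × Fin m) K |
      ∃ i j : Fin m, i ≤ j ∧ p = evenQuad K n m i j} := by
  refine congrArg Ideal.span (Set.ext fun p => ?_)
  simp [evenList_eq_map_upperPairs, mem_upperPairs, eq_comm]

end EvenQuad

/-- The `m(m+1)/2` even orthogonal quadrics `x_{i,j}` (`i ≤ j`) form a regular sequence in
`K[X_{k,i}]`, and the quotient by the ideal they generate (a complete intersection) has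
Krull dimension `2nm − m(m+1)/2`. -/
theorem statement4 (K : Type*) [Field K] (m n : ℕ) (hm : 1 ≤ m) (hmn : m ≤ n) :
    RingTheory.Sequence.IsRegular (MvPolynomial (Fin (2 * n) × Fin m) K) (evenList K n m) ∧
      ringKrullDim ((MvPolynomial (Fin (2 * n) × Fin m) K) ⧸
          Ideal.span {p : MvPolynomial (Fin (2 * n) × Fin m) K |
            ∃ i j : Fin m, i ≤ j ∧ p = evenQuad K n m i j}) =
        (2 * n * m - m * (m + 1) / 2 : ℕ) := by
  set I := Ideal.span {p : MvPolynomial (Fin (2 * n) × Fin m) K |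
    ∃ i j : Fin m, i ≤ j ∧ p = evenQuad K n m i j} with hI
  have hofList : Ideal.ofList (evenList K n m) = I := ofList_evenList K n m
  have hreg := isWeaklyRegular_evenList K hmn
  let P := RingHom.ker (aeval (fun _ => 0) : MvPolynomial (Fin (2 * n) × Fin m) K →ₐ[K] K)
  have hP : P.IsPrime := RingHom.ker_isPrime _
  have hIP : I ≤ P := Ideal.span_le.2 fun p ⟨i, j, _, hp⟩ =>
    hp ▸ evenQuad_mem_ker_aeval_zero K n m i j
  have hlen : (evenList K n m).length = m * (m + 1) / 2 := by
    rw [evenList_eq_map_upperPairs, List.length_map, length_upperPairs]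
  refine ⟨⟨hreg, fun htop => hP.ne_top (top_le_iff.1 ?_)⟩, ?_⟩
  · rw [htop, smul_eq_mul, Ideal.mul_top, hofList]
    exact hIP
  · have hupper := ringKrullDim_quotient_ofList_add_length_le hreg
    rw [hofList, hlen, MvPolynomial.ringKrullDim_of_isNoetherianRing, ringKrullDim_eq_zero_of_field,
      zero_add, Nat.card_eq_fintype_card] at hupper
    have hspan : I.spanFinrank ≤ m * (m + 1) / 2 := by
      classical
      rw [← hofList, ← hlen]
      refine (Submodule.spanFinrank_span_le_ncard_of_finite (List.finite_toSet _)).trans ?_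
      rw [← List.coe_toFinset, Set.ncard_coe_finset]
      exact List.toFinset_card_le _
    have hlower : ((2 * n * m : ℕ) : WithBot ℕ∞) ≤
        ringKrullDim (MvPolynomial (Fin (2 * n) × Fin m) K ⧸ I) + (m * (m + 1) / 2 : ℕ) := by
      have hcard := card_le_height_ker_aeval_zero K (Fin (2 * n) × Fin m)
      rw [Fintype.card_prod, Fintype.card_fin, Fintype.card_fin] at hcard
      refine (WithBot.coe_le_coe.2 hcard).trans
        ((height_le_ringKrullDim_quotient_add_spanFinrank hIP).trans ?_)
      gcongr
    rw [Fintype.card_prod, Fintype.card_fin, Fintype.card_fin] at hupper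
    have hle : m * (m + 1) / 2 ≤ 2 * n * m := by
      refine Nat.div_le_of_le_mul ?_
      nlinarith
    have heq := le_antisymm hupper hlower
    rw [← Nat.sub_add_cancel hle, Nat.cast_add] at heq
    exact (ENat.WithBot.add_natCast_cancel).1 heq
end
end

section
/- Let K be a field, 1 ≤ m ≤ n, and let φ be a 2n × m matrix over K whose columns v_1, …, v_m satisfy ω(v_i, v_j) = 0 for all 1 ≤ i < j ≤ m, where ω(u,w) = Σ_{k=1}^{n} (u_k w_{n+k} − u_{n+k} w_k). Let J(φ) be the Jacobian matrix, of size m(m−1)/2 by 2nm, whose ((i,j),(k,l)) entry is the partial derivative ∂x_{i,j}/∂X_{k,l} evaluated at φ, where x_{i,j} = Σ_{k=1}^{n} (X_{k,i} X_{n+k,j} − X_{n+k,i} X_{k,j}). Then J(φ) has rank m(m−1)/2 if and only if the matrix φ has rank at least m−1. -/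
noncomputable section

open MvPolynomial

/-- The standard symplectic form `ω(u,w) = ∑_{k=1}^{n} (u_k w_{n+k} − u_{n+k} w_k)`
on `K^{2n}`. -/
def sympForm (K : Type*) [Field K] (n : ℕ) (u w : Fin (2 * n) → K) : K :=
  ∑ k : Fin n,
    (u ⟨k.1, by have := k.2; omega⟩ * w ⟨n + k.1, by have := k.2; omega⟩
      - u ⟨n + k.1, by have := k.2; omega⟩ * w ⟨k.1, by have := k.2; omega⟩)

/-- The symplectic quadric `x_{i,j} = ∑_{k=1}^{n} (X_{k,i} X_{n+k,j} − X_{n+k,i} X_{k,j})`. -/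
def sympQuad (K : Type*) [Field K] (n m : ℕ) (i j : Fin m) :
    MvPolynomial (Fin (2 * n) × Fin m) K :=
  ∑ k : Fin n,
    (X (⟨k.1, by have := k.2; omega⟩, i) * X (⟨n + k.1, by have := k.2; omega⟩, j)
      - X (⟨n + k.1, by have := k.2; omega⟩, i) * X (⟨k.1, by have := k.2; omega⟩, j))

/-- The Jacobian matrix of the quadrics `x_{i,j}` (`i < j`), evaluated at a point
`φ ∈ Hom(K^m, K^{2n})`; it has `m(m−1)/2` rows and `2nm` columns. -/
def sympJacobian (K : Type*) [Field K] (n m : ℕ) (φ : Matrix (Fin (2 * n)) (Fin m) K) :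
    Matrix {p : Fin m × Fin m // p.1 < p.2} (Fin (2 * n) × Fin m) K :=
  Matrix.of fun p v =>
    MvPolynomial.eval (fun w : Fin (2 * n) × Fin m => φ w.1 w.2)
      (MvPolynomial.pderiv v (sympQuad K n m p.1.1 p.1.2))

/-- A subspace of `K^ι` has dimension at most one iff it contains the rows of no nonzero
alternating matrix. -/
theorem finrank_le_one_iff_alternating_eq_zero {K ι : Type*} [Field K] [Fintype ι]
    (W : Submodule K (ι → K)) :
    Module.finrank K W ≤ 1 ↔
      ∀ C : Matrix ι ι K, (∀ i, C i i = 0) → (∀ i j, C i j = -C j i) → (∀ i, C i ∈ W) →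
        C = 0 := by
  constructor
  · intro h C hdiag hskew hW
    obtain ⟨a, ha⟩ := finrank_le_one_iff.1 h
    choose t ht using fun i => ha ⟨C i, hW i⟩
    have hC : ∀ i j, C i j = t i * (a : ι → K) j := fun i j => by
      simpa using (congrFun (congrArg Subtype.val (ht i)) j).symm
    ext i j
    have h₁ : t i * (a : ι → K) i = 0 := by rw [← hC, hdiag]
    rcases mul_eq_zero.1 h₁ with h₀ | h₀
    · simp [hC, h₀]
    · rw [hskew, hC, h₀]
      simp
  · intro h
    by_contra hlt
    have hex : ∀ v : W, ∃ w : W, ∀ c : K, c • v ≠ w := by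
      by_contra! hv
      obtain ⟨v, hv⟩ := hv
      exact hlt (finrank_le_one v hv)
    obtain ⟨a, ha⟩ := hex 0
    obtain ⟨b, hb⟩ := hex a
    have hC := h (Matrix.of fun i j => (a : ι → K) i * (b : ι → K) j - (b : ι → K) i * (a : ι → K) j)
      (fun i => by simp [mul_comm]) (fun i j => by simp; ring)
      (fun i => W.sub_mem (W.smul_mem _ b.2) (W.smul_mem _ a.2))
    have ha' : (a : ι → K) ≠ 0 := fun h0 => ha 0 (by ext; simp [h0])
    obtain ⟨i, hi⟩ := Function.ne_iff.1 ha'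
    refine hb ((b : ι → K) i / (a : ι → K) i) ?_
    ext j
    have hij := congrFun (congrFun hC i) j
    simp only [Matrix.of_apply, Matrix.zero_apply] at hij
    simp only [Pi.zero_apply] at hi
    simp only [Submodule.coe_smul, Pi.smul_apply, smul_eq_mul]
    field_simp
    linear_combination -hij

/-- There are `m(m-1)/2` pairs `i < j` in `Fin m`. -/
theorem card_fin_pairs_lt (m : ℕ) :
    Fintype.card {p : Fin m × Fin m // p.1 < p.2} = m * (m - 1) / 2 := by
  rw [Fintype.card_subtype, Finset.card_filter, Fintype.sum_prod_type_right]
  simp only [← Finset.card_filter, Finset.filter_gt_eq_Iio, Fin.card_Iio]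
  rw [Fin.sum_univ_eq_sum_range (fun i => i), Finset.sum_range_id]

theorem sympForm_eq_zero_of_forall_single {K : Type*} [Field K] {n : ℕ} {w : Fin (2 * n) → K}
    (h : ∀ r, sympForm K n (Pi.single r 1) w = 0) : w = 0 := by
  have hsmall : ∀ k : Fin n, w ⟨k.1, by omega⟩ = 0 := fun k => by
    have := h ⟨n + k.1, by omega⟩
    simpa [sympForm, Pi.single_apply, Fin.mk.injEq, Fin.val_inj, Finset.sum_sub_distrib,
      show ∀ x : Fin n, ¬ (x : ℕ) = n + k by intro x; omega] using this
  have hlarge : ∀ k : Fin n, w ⟨n + k.1, by omega⟩ = 0 := fun k => by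
    have := h ⟨k.1, by omega⟩
    simpa [sympForm, Pi.single_apply, Fin.mk.injEq, Fin.val_inj, Finset.sum_sub_distrib,
      show ∀ x : Fin n, ¬ n + (x : ℕ) = k by intro x; omega] using this
  ext r
  by_cases hr : r.1 < n
  · exact hsmall ⟨r, hr⟩
  · have := hlarge ⟨r.1 - n, by omega⟩
    simpa [show n + (r.1 - n) = r.1 by omega] using this

theorem sympForm_mulVec {K : Type*} [Field K] {n m : ℕ} (u : Fin (2 * n) → K)
    (φ : Matrix (Fin (2 * n)) (Fin m) K) (c : Fin m → K) :
    sympForm K n u (φ.mulVec c) = ∑ j, c j * sympForm K n u (fun k => φ k j) := by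
  simp only [sympForm, Matrix.mulVec, dotProduct, Finset.mul_sum]
  rw [Finset.sum_comm]
  refine Finset.sum_congr rfl fun k _ => ?_
  rw [← Finset.sum_sub_distrib]
  exact Finset.sum_congr rfl fun j _ => by ring

theorem sympJacobian_apply {K : Type*} [Field K] {n m : ℕ} (φ : Matrix (Fin (2 * n)) (Fin m) K)
    (p : {p : Fin m × Fin m // p.1 < p.2}) (r : Fin (2 * n)) (l : Fin m) :
    sympJacobian K n m φ p (r, l) =
      (if l = p.1.1 then sympForm K n (Pi.single r 1) (fun k => φ k p.1.2) else 0) -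
      (if l = p.1.2 then sympForm K n (Pi.single r 1) (fun k => φ k p.1.1) else 0) := by
  have hX : ∀ a i, eval (fun w : Fin (2 * n) × Fin m => φ w.1 w.2)
      (pderiv (r, l) (X (a, i))) = (Pi.single r 1 : Fin (2 * n) → K) a * if l = i then 1 else 0 := by
    intro a i
    rw [pderiv_X]
    by_cases h : r = a <;> by_cases h' : l = i <;>
      simp [Prod.ext_iff, h, h', eq_comm]
  simp only [sympJacobian, Matrix.of_apply, sympQuad, map_sum, map_sub, Derivation.leibniz,
    map_add, smul_eq_mul, map_mul, eval_X, hX]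
  rw [← boole_mul (l = p.1.1) (sympForm _ _ _ _), ← boole_mul (l = p.1.2) (sympForm _ _ _ _)]
  simp only [sympForm, Finset.mul_sum, ← Finset.sum_sub_distrib]
  exact Finset.sum_congr rfl fun k _ => by ring

/-- The linear combination of the rows of the Jacobian with coefficients the strictly upper
triangular part of an alternating matrix `C`. -/
theorem vecMul_sympJacobian {K : Type*} [Field K] {n m : ℕ} (φ : Matrix (Fin (2 * n)) (Fin m) K)
    (C : Matrix (Fin m) (Fin m) K) (hdiag : ∀ i, C i i = 0) (hskew : ∀ i j, C i j = -C j i)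
    (r : Fin (2 * n)) (l : Fin m) :
    Matrix.vecMul (fun p : {p : Fin m × Fin m // p.1 < p.2} => C p.1.1 p.1.2)
      (sympJacobian K n m φ) (r, l) = sympForm K n (Pi.single r 1) (φ.mulVec (C l)) := by
  rw [sympForm_mulVec]
  simp only [Matrix.vecMul, dotProduct, sympJacobian_apply]
  generalize hf : (fun j => sympForm K n (Pi.single r 1) (fun k => φ k j)) = f
  simp only [funext_iff] at hf
  simp only [hf]
  rw [← Finset.sum_subtype (Finset.univ.filter fun p : Fin m × Fin m => p.1 < p.2) (by simp)
    (fun p => C p.1 p.2 * ((if l = p.1 then f p.2 else 0) - if l = p.2 then f p.1 else 0)),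
    Finset.sum_filter]
  have hsplit : ∀ p : Fin m × Fin m, (if p.1 < p.2 then
      C p.1 p.2 * ((if l = p.1 then f p.2 else 0) - if l = p.2 then f p.1 else 0) else 0) =
      (if l = p.1 then if p.1 < p.2 then C p.1 p.2 * f p.2 else 0 else 0) -
      (if l = p.2 then if p.1 < p.2 then C p.1 p.2 * f p.1 else 0 else 0) := fun p => by
    split_ifs <;> ring
  simp only [hsplit, Finset.sum_sub_distrib]
  rw [Fintype.sum_prod_type_right, Fintype.sum_prod_type]
  simp only [Finset.sum_ite_eq, Finset.mem_univ, if_true]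
  rw [← Finset.sum_sub_distrib]
  refine Finset.sum_congr rfl fun j _ => ?_
  rcases lt_trichotomy l j with hlj | rfl | hlj
  · simp [hlj, hlj.not_gt]
  · simp [hdiag]
  · simp [hlj, hlj.not_gt, hskew l j]

theorem vecMul_sympJacobian_eq_zero_iff {K : Type*} [Field K] {n m : ℕ}
    (φ : Matrix (Fin (2 * n)) (Fin m) K) (C : Matrix (Fin m) (Fin m) K)
    (hdiag : ∀ i, C i i = 0) (hskew : ∀ i j, C i j = -C j i) :
    Matrix.vecMul (fun p : {p : Fin m × Fin m // p.1 < p.2} => C p.1.1 p.1.2)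
      (sympJacobian K n m φ) = 0 ↔ ∀ l, C l ∈ LinearMap.ker φ.mulVecLin := by
  simp only [LinearMap.mem_ker, Matrix.mulVecLin_apply]
  constructor
  · intro h l
    refine sympForm_eq_zero_of_forall_single fun r => ?_
    rw [← vecMul_sympJacobian φ C hdiag hskew, h, Pi.zero_apply]
  · intro h
    ext ⟨r, l⟩
    rw [vecMul_sympJacobian φ C hdiag hskew, h]
    simp [sympForm]

/-- The rows of the Jacobian are independent iff no nonzero alternating matrix has its rows in
the kernel of `φ`. -/
theorem linearIndependent_row_sympJacobian_iff {K : Type*} [Field K] {n m : ℕ}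
    (φ : Matrix (Fin (2 * n)) (Fin m) K) :
    LinearIndependent K (sympJacobian K n m φ).row ↔
      Module.finrank K (LinearMap.ker φ.mulVecLin) ≤ 1 := by
  rw [finrank_le_one_iff_alternating_eq_zero, ← Matrix.vecMul_injective_iff,
    ← Matrix.coe_vecMulLinear, injective_iff_map_eq_zero]
  simp only [Matrix.coe_vecMulLinear]
  constructor
  · intro h C hdiag hskew hC
    have h0 := h _ ((vecMul_sympJacobian_eq_zero_iff φ C hdiag hskew).2 hC)
    have hlt : ∀ i j, i < j → C i j = 0 := fun i j hij => congrFun h0 ⟨(i, j), hij⟩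
    ext i j
    rcases lt_trichotomy i j with hij | rfl | hij
    · exact hlt i j hij
    · exact hdiag i
    · rw [hskew, hlt j i hij, neg_zero, Matrix.zero_apply]
  · intro h c hc
    let C : Matrix (Fin m) (Fin m) K := Matrix.of fun i j =>
      if hij : i < j then c ⟨(i, j), hij⟩ else if hji : j < i then -c ⟨(j, i), hji⟩ else 0
    have hcC : c = fun p => C p.1.1 p.1.2 := by
      ext p
      simp [C, p.2]
    have hdiag : ∀ i, C i i = 0 := fun i => by simp [C]
    have hskew : ∀ i j, C i j = -C j i := fun i j => by
      rcases lt_trichotomy i j with hij | rfl | hij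
      · simp [C, hij, hij.not_gt]
      · simp [C]
      · simp [C, hij, hij.not_gt]
    rw [hcC] at hc
    have hC := h C hdiag hskew ((vecMul_sympJacobian_eq_zero_iff φ C hdiag hskew).1 hc)
    rw [hcC, hC]
    rfl

/-- For `φ` a point of the symplectic Littlewood variety (pairwise `ω`-orthogonal
columns), the Jacobian of the defining quadrics has full rank `m(m−1)/2` if and only
if `φ` has rank at least `m − 1`. -/
theorem statement8 (K : Type*) [Field K] (m n : ℕ) (hm : 1 ≤ m) (hmn : m ≤ n)
    (φ : Matrix (Fin (2 * n)) (Fin m) K)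
    (hiso : ∀ i j : Fin m, i < j →
      sympForm K n (fun k => φ k i) (fun k => φ k j) = 0) :
    (sympJacobian K n m φ).rank = m * (m - 1) / 2 ↔ m - 1 ≤ φ.rank := by
  have hrank : (sympJacobian K n m φ).rank = m * (m - 1) / 2 ↔
      LinearIndependent K (sympJacobian K n m φ).row := by
    rw [linearIndependent_iff_card_eq_finrank_span, card_fin_pairs_lt,
      Matrix.rank_eq_finrank_span_row, eq_comm]
    rfl
  have hnull : φ.rank + Module.finrank K (LinearMap.ker φ.mulVecLin) = m := by
    have := LinearMap.finrank_range_add_finrank_ker φ.mulVecLin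
    rwa [Module.finrank_fin_fun] at this
  rw [hrank, linearIndependent_row_sympJacobian_iff]
  omega
end
end

section
/- Let K be a field, 1 ≤ m ≤ n, and let φ be a (2n+1) × m matrix over K whose columns v_1, …, v_m satisfy q(v_i) = 0 for all i and ω(v_i, v_j) = 0 for all i < j, where q(u) = Σ_{k=1}^{n} u_k u_{n+k} + u_{2n+1}^2 and ω(u,w) = q(u+w) − q(u) − q(w). Let J(φ) be the Jacobian matrix, of size m(m+1)/2 by (2n+1)m, whose entries are the partial derivatives of the quadrics x_{i,i} = q(v_i) and x_{i,j} = ω(v_i,v_j) (i < j) with respect to the matrix entries, evaluated at φ. Then J(φ) has rank m(m+1)/2 if and only if the matrix φ has rank m. -/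
noncomputable section

open MvPolynomial

/-- The quadratic form `q(u) = ∑_{k=1}^{n} u_k u_{n+k} + u_{2n+1}²` on `K^{2n+1}`. -/
def oddQForm (K : Type*) [Field K] (n : ℕ) (u : Fin (2 * n + 1) → K) : K :=
  (∑ k : Fin n,
    u ⟨k.1, by have := k.2; omega⟩ * u ⟨n + k.1, by have := k.2; omega⟩)
    + u ⟨2 * n, by omega⟩ ^ 2

/-- The associated bilinear form `ω(u,w) = q(u+w) − q(u) − q(w)`. -/
def oddBilForm (K : Type*) [Field K] (n : ℕ) (u w : Fin (2 * n + 1) → K) : K :=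
  oddQForm K n (u + w) - oddQForm K n u - oddQForm K n w

/-- The Jacobian matrix of the quadrics `x_{i,j}` (`i ≤ j`), evaluated at a point
`φ ∈ Hom(K^m, K^{2n+1})`; it has `m(m+1)/2` rows and `(2n+1)m` columns. -/
def oddJacobian (K : Type*) [Field K] (n m : ℕ)
    (φ : Matrix (Fin (2 * n + 1)) (Fin m) K) :
    Matrix {p : Fin m × Fin m // p.1 ≤ p.2} (Fin (2 * n + 1) × Fin m) K :=
  Matrix.of fun p v =>
    MvPolynomial.eval (fun w : Fin (2 * n + 1) × Fin m => φ w.1 w.2)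
      (MvPolynomial.pderiv v (oddQuad K n m p.1.1 p.1.2))

/-- The vector of values `ω(u, e_k)` on the standard basis, as a linear function of `u`. -/
def oddGrad (K : Type*) [Field K] (n : ℕ) :
    (Fin (2 * n + 1) → K) →ₗ[K] (Fin (2 * n + 1) → K) where
  toFun u v :=
    (∑ k : Fin n,
      (u ⟨k.1, by have := k.2; omega⟩ *
          (if (⟨n + k.1, by have := k.2; omega⟩ : Fin (2 * n + 1)) = v then 1 else 0)
        + u ⟨n + k.1, by have := k.2; omega⟩ *
          (if (⟨k.1, by have := k.2; omega⟩ : Fin (2 * n + 1)) = v then 1 else 0)))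
      + 2 * u ⟨2 * n, by omega⟩ *
          (if (⟨2 * n, by omega⟩ : Fin (2 * n + 1)) = v then 1 else 0)
  map_add' u w := by
    funext v
    simp only [Pi.add_apply, add_mul, mul_add, Finset.sum_add_distrib]
    ring
  map_smul' c u := by
    funext v
    simp only [Pi.smul_apply, smul_eq_mul, RingHom.id_apply, mul_add, Finset.mul_sum,
      Finset.sum_add_distrib, mul_assoc, mul_left_comm c]

theorem oddGrad_apply (K : Type*) [Field K] (n : ℕ) (u : Fin (2 * n + 1) → K)
    (v : Fin (2 * n + 1)) :
    oddGrad K n u v = (∑ k : Fin n,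
      (u ⟨k.1, by have := k.2; omega⟩ *
          (if (⟨n + k.1, by have := k.2; omega⟩ : Fin (2 * n + 1)) = v then 1 else 0)
        + u ⟨n + k.1, by have := k.2; omega⟩ *
          (if (⟨k.1, by have := k.2; omega⟩ : Fin (2 * n + 1)) = v then 1 else 0)))
      + 2 * u ⟨2 * n, by omega⟩ *
          (if (⟨2 * n, by omega⟩ : Fin (2 * n + 1)) = v then 1 else 0) := rfl

/-- The radical of `ω` contains no nonzero vector on which `q` vanishes. -/
theorem eq_zero_of_oddGrad_eq_zero {K : Type*} [Field K] {n : ℕ} {u : Fin (2 * n + 1) → K}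
    (hu : oddGrad K n u = 0) (hq : oddQForm K n u = 0) : u = 0 := by
  have h1 : ∀ k : Fin n, u ⟨k.1, by have := k.2; omega⟩ = 0 := by
    intro k
    have h := congrFun hu ⟨n + k.1, by have := k.2; omega⟩
    rw [oddGrad_apply, Finset.sum_eq_single k] at h
    · have e1 : k.1 ≠ n + k.1 := by have := k.2; omega
      have e3 : n ≠ 0 := by have := k.2; omega
      have e2 : 2 * n ≠ n + k.1 := by have := k.2; omega
      simpa [Fin.ext_iff, e1, e2, e3] using h
    · intro b _ hb
      have e1 : b.1 ≠ n + k.1 := by have := b.2; omega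
      have e2 : b.1 ≠ k.1 := fun h => hb (Fin.ext h)
      simp [e1, e2]
    · simp
  have h2 : ∀ k : Fin n, u ⟨n + k.1, by have := k.2; omega⟩ = 0 := by
    intro k
    have h := congrFun hu ⟨k.1, by have := k.2; omega⟩
    rw [oddGrad_apply, Finset.sum_eq_single k] at h
    · have e1 : n + k.1 ≠ k.1 := by have := k.2; omega
      have e3 : n ≠ 0 := by have := k.2; omega
      have e2 : 2 * n ≠ k.1 := by have := k.2; omega
      simpa [Fin.ext_iff, e1, e2, e3] using h
    · intro b _ hb
      have e1 : n + b.1 ≠ k.1 := by have := k.2; omega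
      have e2 : b.1 ≠ k.1 := fun h => hb (Fin.ext h)
      simp [e1, e2]
    · simp
  have h3 : u ⟨2 * n, by omega⟩ = 0 := by
    simpa [oddQForm, h1] using hq
  funext ⟨k, hk⟩
  rcases lt_or_ge k n with h | h
  · exact h1 ⟨k, h⟩
  · rcases eq_or_ne k (2 * n) with rfl | h'
    · exact h3
    · have := h2 ⟨k - n, by omega⟩
      simpa [Nat.add_sub_cancel' h] using this

theorem oddBilForm_eq {K : Type*} [Field K] {n : ℕ} (u w : Fin (2 * n + 1) → K) :
    oddBilForm K n u w = (∑ k : Fin n,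
      (u ⟨k.1, by have := k.2; omega⟩ * w ⟨n + k.1, by have := k.2; omega⟩
        + u ⟨n + k.1, by have := k.2; omega⟩ * w ⟨k.1, by have := k.2; omega⟩))
      + 2 * u ⟨2 * n, by omega⟩ * w ⟨2 * n, by omega⟩ := by
  simp only [oddBilForm, oddQForm, Pi.add_apply, add_mul, mul_add, Finset.sum_add_distrib,
    mul_comm (w _) (u _)]
  ring

theorem oddBilForm_self {K : Type*} [Field K] {n : ℕ} (u : Fin (2 * n + 1) → K) :
    oddBilForm K n u u = 2 * oddQForm K n u := by
  rw [oddBilForm_eq, oddQForm, mul_add, Finset.mul_sum]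
  congr 1
  · exact Finset.sum_congr rfl fun k _ => by ring
  · ring

theorem oddBilForm_comm {K : Type*} [Field K] {n : ℕ} (u w : Fin (2 * n + 1) → K) :
    oddBilForm K n u w = oddBilForm K n w u := by
  rw [oddBilForm, oddBilForm, add_comm u w]
  ring

theorem oddBilForm_add_right {K : Type*} [Field K] {n : ℕ} (u w z : Fin (2 * n + 1) → K) :
    oddBilForm K n u (w + z) = oddBilForm K n u w + oddBilForm K n u z := by
  simp only [oddBilForm_eq, Pi.add_apply, mul_add, Finset.sum_add_distrib]
  ring

theorem oddBilForm_smul_right {K : Type*} [Field K] {n : ℕ} (a : K)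
    (u w : Fin (2 * n + 1) → K) :
    oddBilForm K n u (a • w) = a * oddBilForm K n u w := by
  simp only [oddBilForm_eq, Pi.smul_apply, smul_eq_mul, mul_add, Finset.mul_sum,
    mul_left_comm _ a]

theorem oddQForm_smul {K : Type*} [Field K] {n : ℕ} (a : K) (u : Fin (2 * n + 1) → K) :
    oddQForm K n (a • u) = a ^ 2 * oddQForm K n u := by
  simp only [oddQForm, Pi.smul_apply, smul_eq_mul, mul_add, Finset.mul_sum]
  congr 1
  · exact Finset.sum_congr rfl fun k _ => by ring
  · ring

theorem oddQForm_sum_smul_eq_zero {K : Type*} [Field K] {n : ℕ} {ι : Type*}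
    (v : ι → Fin (2 * n + 1) → K) (hq : ∀ i, oddQForm K n (v i) = 0)
    (hb : ∀ i j, oddBilForm K n (v i) (v j) = 0) (a : ι → K) (s : Finset ι) :
    oddQForm K n (∑ i ∈ s, a i • v i) = 0 := by
  classical
  suffices h : oddQForm K n (∑ i ∈ s, a i • v i) = 0 ∧
      ∀ j, oddBilForm K n (v j) (∑ i ∈ s, a i • v i) = 0 from h.1
  induction s using Finset.induction_on with
  | empty => simp [oddQForm, oddBilForm_eq]
  | insert i s hi ih =>
    rw [Finset.sum_insert hi]
    refine ⟨?_, fun j => ?_⟩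
    · have h : oddBilForm K n (a i • v i) (∑ i ∈ s, a i • v i) = 0 := by
        rw [oddBilForm_comm, oddBilForm_smul_right, oddBilForm_comm, ih.2, mul_zero]
      rw [oddBilForm, oddQForm_smul, hq, ih.1] at h
      simpa using h
    · rw [oddBilForm_add_right, oddBilForm_smul_right, hb, ih.2, mul_zero, add_zero]

theorem oddJacobian_apply {K : Type*} [Field K] {n m : ℕ}
    (φ : Matrix (Fin (2 * n + 1)) (Fin m) K) (p : {p : Fin m × Fin m // p.1 ≤ p.2})
    (k : Fin (2 * n + 1)) (l : Fin m) :
    oddJacobian K n m φ p (k, l) =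
      (if p.1.1 = l then oddGrad K n (φ.col p.1.2) k else 0) +
      (if p.1.1 < p.1.2 then
        if p.1.2 = l then oddGrad K n (φ.col p.1.1) k else 0 else 0) := by
  obtain ⟨⟨i, j⟩, hij⟩ := p
  have hX : ∀ a b, MvPolynomial.eval (fun w : Fin (2 * n + 1) × Fin m => φ w.1 w.2)
      (pderiv (k, l) (X (a, b))) = if a = k then if b = l then 1 else 0 else 0 := by
    intro a b
    rw [pderiv_X, Pi.single_apply]
    simp only [Prod.mk.injEq]
    split_ifs <;> simp_all
  have h2 : pderiv (k, l) (2 : MvPolynomial (Fin (2 * n + 1) × Fin m) K) = 0 :=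
    pderiv_C (a := (2 : K))
  rcases eq_or_lt_of_le hij with h | h
  · dsimp only at h
    subst h
    simp only [oddJacobian, oddQuad, oddGrad_apply, Matrix.of_apply, Matrix.col_apply, if_true,
      map_add, map_sum, Derivation.leibniz, pow_two, smul_eq_mul, map_mul, eval_X, hX,
      lt_irrefl, if_false, add_zero]
    by_cases hl : i = l
    · simp only [hl, if_true, two_mul, add_mul]
    · simp [hl]
  · dsimp only at h
    simp only [oddJacobian, oddQuad, oddGrad_apply, Matrix.of_apply, Matrix.col_apply, h.ne,
      map_add, map_sum, Derivation.leibniz, smul_eq_mul, map_mul, eval_X, hX, h2,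
      mul_zero, add_zero, map_ofNat, h, if_true, if_false]
    by_cases hl : i = l
    · have hl' : j ≠ l := by rintro rfl; exact h.ne hl
      simp only [hl, hl', if_true, if_false, ite_self, mul_zero, add_zero, zero_add]
      congr 1
      · exact Finset.sum_congr rfl fun k _ => by ring
      · ring
    · by_cases hl' : j = l
      · simp only [hl, hl', if_true, if_false, ite_self, mul_zero, add_zero, zero_add]
      · simp [hl, hl']

/-- A combination of the rows of the Jacobian with symmetric coefficients `C`, restricted to
the block of the `l`-th column, is the combination of the gradients with coefficients `C l`. -/
theorem sum_mul_oddJacobian {K : Type*} [Field K] {n m : ℕ}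
    (φ : Matrix (Fin (2 * n + 1)) (Fin m) K) (C : Fin m → Fin m → K)
    (hC : ∀ i j, C i j = C j i) (k : Fin (2 * n + 1)) (l : Fin m) :
    ∑ p : {p : Fin m × Fin m // p.1 ≤ p.2}, C p.1.1 p.1.2 * oddJacobian K n m φ p (k, l) =
      ∑ j, C l j * oddGrad K n (φ.col j) k := by
  simp only [oddJacobian_apply]
  rw [← Finset.sum_subtype (Finset.univ.filter fun p : Fin m × Fin m => p.1 ≤ p.2) (by simp)
    (fun p : Fin m × Fin m => C p.1 p.2 *
      ((if p.1 = l then oddGrad K n (φ.col p.2) k else 0) +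
      (if p.1 < p.2 then if p.2 = l then oddGrad K n (φ.col p.1) k else 0 else 0))),
    Finset.sum_filter, Fintype.sum_prod_type]
  have h : ∀ i j : Fin m, (if i ≤ j then C i j *
      ((if i = l then oddGrad K n (φ.col j) k else 0) +
      (if i < j then if j = l then oddGrad K n (φ.col i) k else 0 else 0)) else 0) =
      (if i = l then if l ≤ j then C l j * oddGrad K n (φ.col j) k else 0 else 0) +
      (if j = l then if i < l then C l i * oddGrad K n (φ.col i) k else 0 else 0) := by
    intro i j
    have := hC i l
    grind
  simp only [h, Finset.sum_add_distrib]
  rw [Finset.sum_comm]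
  simp only [Finset.sum_ite_eq', Finset.mem_univ, if_true]
  rw [← Finset.sum_add_distrib]
  refine Finset.sum_congr rfl fun j _ => ?_
  rcases le_or_gt l j with h | h
  · simp [h, not_lt.mpr h]
  · simp [h, not_le.mpr h]

theorem linearIndependent_row_oddJacobian_iff {K : Type*} [Field K] {n m : ℕ}
    (φ : Matrix (Fin (2 * n + 1)) (Fin m) K) :
    LinearIndependent K (oddJacobian K n m φ).row ↔
      LinearIndependent K fun j => oddGrad K n (φ.col j) := by
  rw [Fintype.linearIndependent_iff, Fintype.linearIndependent_iff]
  constructor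
  · intro h a ha i
    have h0 := h (fun p => a p.1.1 * a p.1.2) (by
      funext ⟨k, l⟩
      have := sum_mul_oddJacobian φ (fun i j => a i * a j) (fun i j => mul_comm _ _) k l
      have ha' := congrFun ha k
      simp only [Finset.sum_apply, Pi.smul_apply, smul_eq_mul, Pi.zero_apply] at ha'
      simp only [Finset.sum_apply, Pi.smul_apply, smul_eq_mul, Pi.zero_apply, Matrix.row_apply]
      rw [this]
      simp only [mul_assoc, ← Finset.mul_sum, ha', mul_zero]) ⟨(i, i), le_rfl⟩
    simpa using h0
  · intro h c hc
    have key : ∀ l j, c ⟨(min l j, max l j), min_le_max⟩ = 0 := by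
      intro l
      refine h _ ?_
      funext k
      have := sum_mul_oddJacobian φ (fun i j => c ⟨(min i j, max i j), min_le_max⟩)
        (fun i j => by simp only [min_comm, max_comm]) k l
      have hc' := congrFun hc (k, l)
      simp only [Finset.sum_apply, Pi.smul_apply, smul_eq_mul, Pi.zero_apply,
        Matrix.row_apply] at hc'
      simp only [Finset.sum_apply, Pi.smul_apply, smul_eq_mul, Pi.zero_apply]
      rw [← this, ← hc']
      refine Finset.sum_congr rfl fun p _ => ?_
      simp only [min_eq_left p.2, max_eq_right p.2]
    rintro ⟨⟨i, j⟩, hij⟩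
    have := key i j
    simpa only [min_eq_left hij, max_eq_right hij] using this

theorem linearIndependent_oddGrad_iff {K : Type*} [Field K] {n : ℕ} {ι : Type*} [Fintype ι]
    (v : ι → Fin (2 * n + 1) → K) (hq : ∀ i, oddQForm K n (v i) = 0)
    (hb : ∀ i j, oddBilForm K n (v i) (v j) = 0) :
    (LinearIndependent K fun j => oddGrad K n (v j)) ↔ LinearIndependent K v := by
  refine ⟨LinearIndependent.of_comp (oddGrad K n), fun h => ?_⟩
  rw [Fintype.linearIndependent_iff] at h ⊢
  intro a ha
  refine h a (eq_zero_of_oddGrad_eq_zero ?_ (oddQForm_sum_smul_eq_zero v hq hb a _))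
  simpa only [map_sum, map_smul] using ha

theorem rank_eq_card_iff_linearIndependent_row {K : Type*} [Field K] {α β : Type*}
    [Fintype α] [Fintype β] (A : Matrix α β K) :
    A.rank = Fintype.card α ↔ LinearIndependent K A.row := by
  rw [linearIndependent_iff_card_eq_finrank_span, Matrix.rank_eq_finrank_span_row, eq_comm]
  rfl

theorem card_prod_le (m : ℕ) :
    Fintype.card {p : Fin m × Fin m // p.1 ≤ p.2} = m * (m + 1) / 2 := by
  rw [← Fintype.card_congr Sym2.sortEquiv, Sym2.card, Fintype.card_fin, Nat.choose_two_right,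
    Nat.add_sub_cancel, mul_comm]

/-- For `φ` a point of the odd orthogonal Littlewood variety (columns spanning an
isotropic subspace), the Jacobian of the defining quadrics has full rank `m(m+1)/2`
if and only if `φ` has rank `m`. -/
theorem statement9 (K : Type*) [Field K] (m n : ℕ) (hm : 1 ≤ m) (hmn : m ≤ n)
    (φ : Matrix (Fin (2 * n + 1)) (Fin m) K)
    (hq : ∀ i : Fin m, oddQForm K n (fun k => φ k i) = 0)
    (hb : ∀ i j : Fin m, i < j →
      oddBilForm K n (fun k => φ k i) (fun k => φ k j) = 0) :
    (oddJacobian K n m φ).rank = m * (m + 1) / 2 ↔ φ.rank = m := by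
  have hb' : ∀ i j, oddBilForm K n (φ.col i) (φ.col j) = 0 := by
    intro i j
    rcases lt_trichotomy i j with h | rfl | h
    · exact hb i j h
    · rw [oddBilForm_self]
      exact (congrArg (2 * ·) (hq i)).trans (mul_zero 2)
    · rw [oddBilForm_comm]
      exact hb j i h
  rw [← card_prod_le, rank_eq_card_iff_linearIndependent_row,
    linearIndependent_row_oddJacobian_iff, linearIndependent_oddGrad_iff φ.col hq hb',
    ← Matrix.rank_transpose φ]
  have := rank_eq_card_iff_linearIndependent_row φ.transpose
  rw [Fintype.card_fin] at this
  exact this.symm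
end
end

section
/- Let λ = (λ_1 ≥ λ_2 ≥ ⋯) be a partition, with λ_k = 0 for k > ℓ(λ), and let λ† denote its transpose (conjugate) partition, λ†_i = #{j : λ_j ≥ i}. Then λ = λ† if and only if there is no pair of indices 1 ≤ i < j with λ_i + λ_j + 1 = i + j. -/
/-- A strictly increasing self-map of `{1, …, d}` is the identity. -/
theorem eq_self_of_strictMonoOn_Icc {d : ℕ} {f : ℕ → ℕ} (hf : StrictMonoOn f (Set.Icc 1 d))
    (hmaps : Set.MapsTo f (Set.Icc 1 d) (Set.Icc 1 d)) {i : ℕ} (hi : i ∈ Set.Icc 1 d) :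
    f i = i := by
  have grow : ∀ n a : ℕ, 1 ≤ a → a + n ≤ d → f a + n ≤ f (a + n) := by
    intro n a ha
    induction n with
    | zero => simp
    | succ n ih =>
      intro h
      have := ih (by omega)
      have : f (a + n) < f (a + (n + 1)) := hf ⟨by omega, by omega⟩ ⟨by omega, h⟩ (by omega)
      omega
  obtain ⟨h1, hd⟩ := hi
  have hlow := grow (i - 1) 1 le_rfl (by omega)
  have hup := grow (d - i) i h1 (by omega)
  rw [show 1 + (i - 1) = i by omega] at hlow
  rw [show i + (d - i) = d by omega] at hup
  have hf1 := (hmaps (show 1 ∈ Set.Icc 1 d from ⟨le_rfl, by omega⟩)).1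
  have hfd := (hmaps (show d ∈ Set.Icc 1 d from ⟨by omega, le_rfl⟩)).2
  omega

/-- A property of positive integers that is bounded and downward closed
describes an initial segment. -/
theorem exists_le_iff_of_downward_closed {P : ℕ → Prop} {N : ℕ}
    (hdown : ∀ i j, 1 ≤ i → i ≤ j → P j → P i) (hbdd : ∀ j, 1 ≤ j → P j → j ≤ N) :
    ∃ d, ∀ j, 1 ≤ j → (j ≤ d ↔ P j) := by
  classical
  refine ⟨Nat.findGreatest P N, fun j hj => ⟨fun h => ?_, fun h => ?_⟩⟩
  · exact hdown _ _ hj h (Nat.findGreatest_of_ne_zero rfl (by omega))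
  · exact Nat.le_findGreatest (hbdd j hj h) h

/-- The number of positive indices `j` with `i ≤ lam j` is characterised by the Galois relation
between a partition and its transpose. -/
theorem le_ncard_iff_le {lam : ℕ → ℕ}
    (hanti : ∀ i j : ℕ, 1 ≤ i → i ≤ j → lam j ≤ lam i)
    (hfin : ∃ N, ∀ k, N ≤ k → lam k = 0) {i j : ℕ} (hi : 1 ≤ i) (hj : 1 ≤ j) :
    j ≤ Set.ncard {j : ℕ | 1 ≤ j ∧ i ≤ lam j} ↔ i ≤ lam j := by
  obtain ⟨N, hN⟩ := hfin
  obtain ⟨d, hd⟩ := exists_le_iff_of_downward_closed (P := fun j => i ≤ lam j) (N := N)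
    (fun a b ha hab h => h.trans (hanti a b ha hab))
    (fun j _ h => by
      by_contra hlt
      have := hN j (by omega)
      omega)
  have hset : {j : ℕ | 1 ≤ j ∧ i ≤ lam j} = (Finset.Icc 1 d : Finset ℕ) := by
    ext j
    simp only [Set.mem_ofPred_eq, Finset.coe_Icc, Set.mem_Icc]
    exact and_congr_right fun h => (hd j h).symm
  rw [hset, Set.ncard_coe_finset, Nat.card_Icc, Nat.add_sub_cancel]
  exact hd j hj

section Transpose

variable {lam mu : ℕ → ℕ}

/-- For a diagonal index `i`, the reflection of the content `lam i - i` avoids the contents of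
`lam` only if `lam i - i` is a content `mu k - k` of the transpose. -/
theorem exists_transpose_content_eq
    (hanti : ∀ i j : ℕ, 1 ≤ i → i ≤ j → lam j ≤ lam i)
    (hmu : ∀ i j : ℕ, 1 ≤ i → 1 ≤ j → (j ≤ mu i ↔ i ≤ lam j))
    (hno : ¬∃ i j : ℕ, 1 ≤ i ∧ i < j ∧ lam i + lam j + 1 = i + j)
    {i : ℕ} (hi : 1 ≤ i) (hdiag : i ≤ lam i) :
    ∃ k, 1 ≤ k ∧ k ≤ mu k ∧ mu k + i = lam i + k := by
  obtain ⟨j, hj⟩ := exists_le_iff_of_downward_closed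
    (P := fun j => j + i ≤ lam i + lam j) (N := lam i + lam 1)
    (fun a b ha hab h => by have := hanti a b ha hab; omega)
    (fun b hb h => by have := hanti 1 b le_rfl hb; omega)
  have hij : i ≤ j := (hj i hi).2 (by omega)
  have hle := (hj j (by omega)).1 le_rfl
  have hlt : ¬(j + 1 + i ≤ lam i + lam (j + 1)) := fun h => by
    have := (hj (j + 1) (by omega)).2 h
    omega
  have hne : lam i + lam (j + 1) + 1 ≠ i + (j + 1) := fun h =>
    hno ⟨i, j + 1, hi, by omega, h⟩
  have hk : 1 ≤ j + i - lam i := by omega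
  have hge := (hmu _ j hk (by omega)).2 (by omega)
  have hle' : ¬(j + 1 ≤ mu (j + i - lam i)) := fun h => by
    have := (hmu _ (j + 1) hk (by omega)).1 h
    omega
  exact ⟨j + i - lam i, hk, by omega, by omega⟩

/-- If no two distinct contents of `lam` are reflections of each other, then `lam` is equal to
its transpose `mu`. -/
theorem eq_transpose_of_no_reflected_contents
    (hanti : ∀ i j : ℕ, 1 ≤ i → i ≤ j → lam j ≤ lam i)
    (hmu : ∀ i j : ℕ, 1 ≤ i → 1 ≤ j → (j ≤ mu i ↔ i ≤ lam j))
    (hno : ¬∃ i j : ℕ, 1 ≤ i ∧ i < j ∧ lam i + lam j + 1 = i + j)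
    {i : ℕ} (hi : 1 ≤ i) : lam i = mu i := by
  have hmu_anti : ∀ a b : ℕ, 1 ≤ a → a ≤ b → mu b ≤ mu a := by
    intro a b ha hab
    rcases Nat.eq_zero_or_pos (mu b) with h | h
    · omega
    · have := (hmu b (mu b) (by omega) h).1 le_rfl
      exact (hmu a (mu b) ha h).2 (by omega)
  obtain ⟨d, hd⟩ := exists_le_iff_of_downward_closed (P := fun j => j ≤ lam j) (N := lam 1)
    (fun a b ha hab h => by have := hanti a b ha hab; omega)
    (fun b hb h => by have := hanti 1 b le_rfl hb; omega)
  have hcontent : ∀ a, ∃ k, a ∈ Set.Icc 1 d → 1 ≤ k ∧ k ≤ mu k ∧ mu k + a = lam a + k := by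
    intro a
    by_cases ha : a ∈ Set.Icc 1 d
    · obtain ⟨k, hk⟩ := exists_transpose_content_eq hanti hmu hno ha.1 ((hd a ha.1).1 ha.2)
      exact ⟨k, fun _ => hk⟩
    · exact ⟨0, fun h => absurd h ha⟩
  choose f hf using hcontent
  have hmono : StrictMonoOn f (Set.Icc 1 d) := by
    intro a ha b hb hab
    obtain ⟨ha1, -, ha3⟩ := hf a ha
    obtain ⟨hb1, -, hb3⟩ := hf b hb
    have := hanti a b ha.1 hab.le
    by_contra! hle
    have := hmu_anti _ _ hb1 hle
    omega
  have hmaps : Set.MapsTo f (Set.Icc 1 d) (Set.Icc 1 d) := by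
    intro a ha
    obtain ⟨h1, h2, -⟩ := hf a ha
    exact ⟨h1, (hd _ h1).2 ((hmu _ _ h1 h1).1 h2)⟩
  have hdiag : ∀ a, 1 ≤ a → a ≤ d → lam a = mu a := by
    intro a ha had
    have h := (hf a ⟨ha, had⟩).2.2
    rw [eq_self_of_strictMonoOn_Icc hmono hmaps ⟨ha, had⟩] at h
    omega
  rcases Nat.lt_or_ge d i with hdi | hid
  · have hsucc : ¬(d + 1 ≤ lam (d + 1)) := fun h => by
      have := (hd (d + 1) (by omega)).2 h
      omega
    refine eq_of_forall_le_iff fun k => ?_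
    rcases Nat.eq_zero_or_pos k with rfl | hk
    · simp
    rcases Nat.lt_or_ge d k with hdk | hkd
    · have := hanti (d + 1) i (by omega) hdi
      have := hanti (d + 1) k (by omega) hdk
      rw [hmu i k hi hk]
      omega
    · rw [← hmu k i hk hi, hmu i k hi hk, hdiag k hk hkd]
  · exact hdiag i hi hid

end Transpose

/-- A partition `λ` (indexed so that `λ_1 ≥ λ_2 ≥ ⋯`, with `λ_k = 0` for large `k`)
is self-conjugate (`λ = λ†`, where `λ†_i = #{j : λ_j ≥ i}`) if and only if there is
no pair of indices `1 ≤ i < j` with `λ_i + λ_j + 1 = i + j`. -/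
theorem statement10 (lam : ℕ → ℕ)
    (hanti : ∀ i j : ℕ, 1 ≤ i → i ≤ j → lam j ≤ lam i)
    (hfin : ∃ N, ∀ k, N ≤ k → lam k = 0) :
    (∀ i : ℕ, 1 ≤ i → lam i = Set.ncard {j : ℕ | 1 ≤ j ∧ i ≤ lam j}) ↔
      ¬∃ i j : ℕ, 1 ≤ i ∧ i < j ∧ lam i + lam j + 1 = i + j := by
  refine ⟨?_, fun hno i hi => eq_transpose_of_no_reflected_contents hanti
    (fun _ _ hi hj => le_ncard_iff_le hanti hfin hi hj) hno hi⟩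
  rintro hself ⟨i, j, hi, hij, h⟩
  have hsymm : j ≤ lam i ↔ i ≤ lam j := by
    rw [hself i hi]
    exact le_ncard_iff_le hanti hfin hi (by omega)
  omega
end

section
/- Let K be a field of characteristic 0 and let R = K[x_1,…,x_6, y_1,…,y_6, z_{ij} (1 ≤ i < j ≤ 6)] be a polynomial ring in 27 variables. Extend z skew-symmetrically by z_{ji} = −z_{ij}, let Z = (z_{ij}) be the corresponding 6 × 6 skew-symmetric matrix, and let Pf(Z) be its Pfaffian, i.e., the signed sum Σ ε(M) z_{a_1 b_1} z_{a_2 b_2} z_{a_3 b_3} over the 15 perfect matchings M = {{a_1,b_1},{a_2,b_2},{a_3,b_3}} of {1,…,6}, with ε(M) the sign of the permutation (a_1 b_1 a_2 b_2 a_3 b_3). Set P = Pf(Z) + Σ_{i ≠ j} z_{ij} x_i y_j ∈ R. Then the ideal I ⊆ R generated by the 27 partial derivatives of P is a prime ideal of height 10. -/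
noncomputable section

open MvPolynomial

/-- Index type for the 27 variables `x₁,…,x₆, y₁,…,y₆, z_{ij} (1 ≤ i < j ≤ 6)`. -/
abbrev E6Var : Type := Fin 6 ⊕ Fin 6 ⊕ {p : Fin 6 × Fin 6 // p.1 < p.2}

/-- The variable `x_i`. -/
def xv (K : Type*) [Field K] (i : Fin 6) : MvPolynomial E6Var K :=
  X (Sum.inl i)

/-- The variable `y_i`. -/
def yv (K : Type*) [Field K] (i : Fin 6) : MvPolynomial E6Var K :=
  X (Sum.inr (Sum.inl i))

/-- The skew-symmetric extension of the variables `z_{ij}`: `z_{ji} = −z_{ij}` and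
`z_{ii} = 0`. -/
def zv (K : Type*) [Field K] (i j : Fin 6) : MvPolynomial E6Var K :=
  if h : i < j then X (Sum.inr (Sum.inr ⟨(i, j), h⟩))
  else if h : j < i then -X (Sum.inr (Sum.inr ⟨(j, i), h⟩))
  else 0

/-- The Pfaffian of the `6 × 6` skew-symmetric matrix `Z = (z_{ij})`, i.e. the signed
sum over the 15 perfect matchings of `{1,…,6}` (0-indexed here). -/
def pfZ (K : Type*) [Field K] : MvPolynomial E6Var K :=
  zv K 0 1 * zv K 2 3 * zv K 4 5 - zv K 0 1 * zv K 2 4 * zv K 3 5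
    + zv K 0 1 * zv K 2 5 * zv K 3 4 - zv K 0 2 * zv K 1 3 * zv K 4 5
    + zv K 0 2 * zv K 1 4 * zv K 3 5 - zv K 0 2 * zv K 1 5 * zv K 3 4
    + zv K 0 3 * zv K 1 2 * zv K 4 5 - zv K 0 3 * zv K 1 4 * zv K 2 5
    + zv K 0 3 * zv K 1 5 * zv K 2 4 - zv K 0 4 * zv K 1 2 * zv K 3 5
    + zv K 0 4 * zv K 1 3 * zv K 2 5 - zv K 0 4 * zv K 1 5 * zv K 2 3
    + zv K 0 5 * zv K 1 2 * zv K 3 4 - zv K 0 5 * zv K 1 3 * zv K 2 4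
    + zv K 0 5 * zv K 1 4 * zv K 2 3

/-- The unique cubic `E₆`-invariant `P = Pf(Z) + ∑_{i ≠ j} z_{ij} x_i y_j`. -/
def cubicP (K : Type*) [Field K] : MvPolynomial E6Var K :=
  pfZ K + ∑ i : Fin 6, ∑ j : Fin 6, if i = j then 0 else zv K i j * xv K i * yv K j

/-- The ideal generated by the 27 partial derivatives of `P`. -/
def e6Ideal (K : Type*) [Field K] : Ideal (MvPolynomial E6Var K) :=
  Ideal.span (Set.range fun v : E6Var => MvPolynomial.pderiv v (cubicP K))

section SecondOrder

variable {σ R : Type*} [CommRing R]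

theorem pderiv_comm_apply (i j : σ) (f : MvPolynomial σ R) :
    pderiv i (pderiv j f) = pderiv j (pderiv i f) := by
  classical
  let D (k : σ) : Derivation R (MvPolynomial σ R) (MvPolynomial σ R) := pderiv k
  have h : ⁅D i, D j⁆ = 0 := by
    refine MvPolynomial.derivation_ext fun k => ?_
    rw [Derivation.commutator_apply]
    simp [D, pderiv_X, Pi.single_apply, apply_ite]
  have := congrArg (fun D => D f) h
  rwa [Derivation.commutator_apply, Derivation.zero_apply, sub_eq_zero] at this

variable [Fintype σ]

/-- The differential operator `∑ A a b ∂_a ∂_b + ∑ c a ∂_a`. -/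
def diffOp (A : σ → σ → MvPolynomial σ R) (c : σ → MvPolynomial σ R) (f : MvPolynomial σ R) :
    MvPolynomial σ R :=
  ∑ a, ∑ b, A a b * pderiv a (pderiv b f) + ∑ a, c a * pderiv a f

/-- The bilinear form measuring the failure of `diffOp A c` to be a derivation. -/
def diffOpCross (A : σ → σ → MvPolynomial σ R) (f g : MvPolynomial σ R) : MvPolynomial σ R :=
  2 * ∑ a, pderiv a f * ∑ b, A a b * pderiv b g

variable {A : σ → σ → MvPolynomial σ R} {c : σ → MvPolynomial σ R}

theorem diffOp_add (f g : MvPolynomial σ R) :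
    diffOp A c (f + g) = diffOp A c f + diffOp A c g := by
  simp only [diffOp, map_add, mul_add, Finset.sum_add_distrib]
  ring

theorem diffOp_mul (hA : ∀ a b, A a b = A b a) (f g : MvPolynomial σ R) :
    diffOp A c (f * g) = diffOp A c f * g + f * diffOp A c g + diffOpCross A f g := by
  have hsymm : ∑ a, ∑ b, A a b * (pderiv b f * pderiv a g) =
      ∑ a, ∑ b, A a b * (pderiv a f * pderiv b g) := by
    rw [Finset.sum_comm]
    exact Finset.sum_congr rfl fun a _ => Finset.sum_congr rfl fun b _ => by rw [hA]
  have hcross : diffOpCross A f g = 2 * ∑ a, ∑ b, A a b * (pderiv a f * pderiv b g) := by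
    simp_rw [diffOpCross, Finset.mul_sum, mul_left_comm]
  have hone : ∑ a, c a * pderiv a (f * g) =
      (∑ a, c a * pderiv a f) * g + f * ∑ a, c a * pderiv a g := by
    simp_rw [Finset.sum_mul, Finset.mul_sum, ← Finset.sum_add_distrib, pderiv_mul]
    exact Finset.sum_congr rfl fun a _ => by ring
  have htwo : ∑ a, ∑ b, A a b * pderiv a (pderiv b (f * g)) =
      (∑ a, ∑ b, A a b * pderiv a (pderiv b f)) * g +
        f * (∑ a, ∑ b, A a b * pderiv a (pderiv b g)) +
        (∑ a, ∑ b, A a b * (pderiv a f * pderiv b g) +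
          ∑ a, ∑ b, A a b * (pderiv b f * pderiv a g)) := by
    simp_rw [Finset.sum_mul, Finset.mul_sum, ← Finset.sum_add_distrib, pderiv_mul, map_add,
      pderiv_mul]
    exact Finset.sum_congr rfl fun a _ => Finset.sum_congr rfl fun b _ => by ring
  rw [diffOp, hone, htwo, hsymm, hcross, diffOp, diffOp]
  ring

theorem diffOpCross_mul (f g h : MvPolynomial σ R) :
    diffOpCross A (f * g) h = f * diffOpCross A g h + g * diffOpCross A f h := by
  have hsum : ∑ a, pderiv a (f * g) * ∑ b, A a b * pderiv b h =
      f * ∑ a, pderiv a g * ∑ b, A a b * pderiv b h +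
        g * ∑ a, pderiv a f * ∑ b, A a b * pderiv b h := by
    rw [Finset.mul_sum, Finset.mul_sum, ← Finset.sum_add_distrib]
    exact Finset.sum_congr rfl fun a _ => by rw [pderiv_mul]; ring
  rw [diffOpCross, hsum, diffOpCross, diffOpCross]
  ring

theorem diffOp_mem_span {ι : Type*} {p : ι → MvPolynomial σ R} (hA : ∀ a b, A a b = A b a)
    (hp : ∀ w, diffOp A c (p w) ∈ Ideal.span (Set.range p))
    (hc : ∀ a w, ∑ b, A a b * pderiv b (p w) ∈ Ideal.span (Set.range p))
    {f : MvPolynomial σ R} (hf : f ∈ Ideal.span (Set.range p)) :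
    diffOp A c f ∈ Ideal.span (Set.range p) := by
  induction hf using Submodule.span_induction with
  | mem x hx =>
    obtain ⟨w, rfl⟩ := hx
    exact hp w
  | zero => simp [diffOp]
  | add x y _ _ hx hy => rw [diffOp_add]; exact add_mem hx hy
  | smul r x hx h =>
    rw [smul_eq_mul, diffOp_mul hA]
    refine add_mem (add_mem (Ideal.mul_mem_left _ _ hx) (Ideal.mul_mem_left _ _ h)) ?_
    refine Ideal.mul_mem_left _ _ (sum_mem fun a _ => Ideal.mul_mem_left _ _ ?_)
    clear h
    induction hx using Submodule.span_induction with
    | mem x hx =>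
      obtain ⟨w, rfl⟩ := hx
      exact hc a w
    | zero => simp
    | add x y _ _ hx hy =>
      simp only [map_add, mul_add, Finset.sum_add_distrib]
      exact add_mem hx hy
    | smul s x hx h =>
      have : ∑ b, A a b * pderiv b (s • x) =
          (∑ b, A a b * pderiv b s) * x + s * ∑ b, A a b * pderiv b x := by
        simp only [smul_eq_mul, pderiv_mul, mul_add, Finset.sum_add_distrib, Finset.mul_sum,
          Finset.sum_mul]
        congr 1 <;> exact Finset.sum_congr rfl fun b _ => by ring
      rw [this]
      exact add_mem (Ideal.mul_mem_left _ _ hx) (Ideal.mul_mem_left _ _ h)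

theorem diffOpCross_pow_mul_mem {I : Ideal (MvPolynomial σ R)} {t : MvPolynomial σ R}
    (hI : ∀ f ∈ I, diffOpCross A f t ∈ I) (k : ℕ) (f : MvPolynomial σ R) (hf : t ^ k * f ∈ I) :
    t ^ (k + 1) * diffOpCross A f t ∈ I := by
  induction k generalizing f with
  | zero => exact Ideal.mul_mem_left _ _ (hI f (by simpa using hf))
  | succ k ih =>
    have h1 := ih (t * f) (by rwa [pow_succ, mul_assoc] at hf)
    rw [diffOpCross_mul] at h1
    have h2 := Ideal.mul_mem_right (diffOpCross A t t) _ hf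
    have : t ^ (k + 1 + 1) * diffOpCross A f t =
        t ^ (k + 1) * (t * diffOpCross A f t + f * diffOpCross A t t) -
          t ^ (k + 1) * f * diffOpCross A t t := by ring
    rw [this]
    exact sub_mem h1 h2

theorem diffOp_pow_mul_mem {I : Ideal (MvPolynomial σ R)} {t : MvPolynomial σ R}
    (hA : ∀ a b, A a b = A b a) (hI : ∀ f ∈ I, diffOp A c f ∈ I) (k : ℕ)
    (f : MvPolynomial σ R) (hf : t ^ k * f ∈ I) : t ^ (k + 2) * diffOp A c f ∈ I := by
  have hG : ∀ f ∈ I, diffOpCross A f t ∈ I := fun f hf => by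
    have h := hI (f * t) (Ideal.mul_mem_right _ _ hf)
    rw [diffOp_mul hA] at h
    exact (Ideal.add_mem_iff_right _ (add_mem (Ideal.mul_mem_right _ _ (hI f hf))
      (Ideal.mul_mem_right _ _ hf))).mp h
  induction k generalizing f with
  | zero => exact Ideal.mul_mem_left _ _ (hI f (by simpa using hf))
  | succ k ih =>
    have h1 := ih (f * t) (by convert hf using 1; ring)
    rw [diffOp_mul hA] at h1
    have h2 := diffOpCross_pow_mul_mem hG (k + 1) f hf
    have : t ^ (k + 1 + 2) * diffOp A c f =
        t ^ (k + 2) * (diffOp A c f * t + f * diffOp A c t + diffOpCross A f t) -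
          t * diffOp A c t * (t ^ (k + 1) * f) - t ^ (k + 1 + 1) * diffOpCross A f t := by ring
    rw [this]
    exact sub_mem (sub_mem h1 (Ideal.mul_mem_left _ _ hf)) h2

end SecondOrder

section Cubic

variable {σ K : Type*} [Field K]

/-- The coefficients of the trilinear form of third partial derivatives of a cubic form. -/
def thirdCoeff (P : MvPolynomial σ K) (u v w : σ) : K :=
  constantCoeff (pderiv u (pderiv v (pderiv w P)))

theorem thirdCoeff_swap₁₂ (P : MvPolynomial σ K) (u v w : σ) :
    thirdCoeff P u v w = thirdCoeff P v u w := by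
  rw [thirdCoeff, pderiv_comm_apply, thirdCoeff]

theorem thirdCoeff_swap₂₃ (P : MvPolynomial σ K) (u v w : σ) :
    thirdCoeff P u v w = thirdCoeff P u w v := by
  rw [thirdCoeff, pderiv_comm_apply v w, thirdCoeff]

theorem pderiv_pderiv_pderiv_eq_C {P : MvPolynomial σ K} (hP : P.IsHomogeneous 3) (u v w : σ) :
    pderiv u (pderiv v (pderiv w P)) = C (thirdCoeff P u v w) := by
  have h : (pderiv u (pderiv v (pderiv w P))).IsHomogeneous 0 := hP.pderiv.pderiv.pderiv
  rw [← totalDegree_zero_iff_isHomogeneous, totalDegree_eq_zero_iff_eq_C] at h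
  rw [thirdCoeff, constantCoeff_eq, ← h]

theorem sum_X_mul_pderiv_pderiv [Fintype σ] {P : MvPolynomial σ K} (hP : P.IsHomogeneous 3) (v : σ) :
    ∑ a, X a * pderiv a (pderiv v P) = 2 * pderiv v P := by
  rw [hP.pderiv.sum_X_mul_pderiv, nsmul_eq_mul]
  norm_num

theorem sum_X_mul_thirdCoeff [Fintype σ] {P : MvPolynomial σ K} (hP : P.IsHomogeneous 3) (u v : σ) :
    ∑ a, X a * C (thirdCoeff P a u v) = pderiv u (pderiv v P) := by
  simp_rw [← pderiv_pderiv_pderiv_eq_C hP]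
  rw [hP.pderiv.pderiv.sum_X_mul_pderiv, nsmul_eq_mul]
  norm_num

/-- The ideal generated by the partial derivatives. -/
def gradIdeal (P : MvPolynomial σ K) : Ideal (MvPolynomial σ K) :=
  Ideal.span (Set.range fun v : σ => pderiv v P)

theorem pderiv_mem_gradIdeal (P : MvPolynomial σ K) (v : σ) : pderiv v P ∈ gradIdeal P :=
  Ideal.subset_span ⟨v, rfl⟩

variable [Fintype σ]

/-- The contraction of the second partial derivatives at the origin with a matrix. -/
def contract (T : σ → σ → K) : MvPolynomial σ K →ₗ[K] K :=
  ∑ a, ∑ b, T a b • (lcoeff K 0 ∘ₗ (pderiv a).toLinearMap ∘ₗ (pderiv b).toLinearMap)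

theorem contract_apply (T : σ → σ → K) (f : MvPolynomial σ K) :
    contract T f = ∑ a, ∑ b, T a b * constantCoeff (pderiv a (pderiv b f)) := by
  simp [contract, constantCoeff_eq, lcoeff]

theorem contract_X_mul_X [DecidableEq σ] (T : σ → σ → K) (i j : σ) :
    contract T (X i * X j) = T i j + T j i := by
  have h : ∀ x y : σ, constantCoeff (Pi.single (M := fun _ => MvPolynomial σ K) x 1 y) =
      if y = x then 1 else 0 := fun x y => by
    rw [Pi.single_apply, apply_ite constantCoeff, map_one, map_zero]
  simp [contract_apply, h, mul_add, Finset.sum_add_distrib, pderiv_X, add_comm]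

variable [DecidableEq σ]

/-- A cubic form whose gradient map squares to multiplication by the form, and whose third
derivatives satisfy a trace identity. -/
structure IsAdjointCubic (P : MvPolynomial σ K) (n : ℕ) : Prop where
  isHomogeneous : P.IsHomogeneous 3
  aeval_pderiv (a : σ) : aeval (fun b => pderiv b P) (pderiv a P) = P * X a
  trace (v w : σ) : ∑ a, ∑ b, thirdCoeff P v a b * thirdCoeff P w a b =
    if v = w then 2 * ((n : K) + 1) else 0

/-- The symbol of the Bessel operator. -/
def besselCoeff (P : MvPolynomial σ K) (u a b : σ) : MvPolynomial σ K :=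
  (if b = u then X a else 0) + (if a = u then X b else 0) -
    ∑ v, pderiv u (pderiv v P) * C (thirdCoeff P v a b)

/-- The Bessel operator of a cubic form in the direction `u`. -/
def bessel (P : MvPolynomial σ K) (n : ℕ) (u : σ) : MvPolynomial σ K → MvPolynomial σ K :=
  diffOp (besselCoeff P u) (fun a => if a = u then 2 * (n : MvPolynomial σ K) else 0)

theorem besselCoeff_symm (P : MvPolynomial σ K) (u a b : σ) :
    besselCoeff P u a b = besselCoeff P u b a := by
  simp_rw [besselCoeff, thirdCoeff_swap₂₃ P _ a b]
  ring

namespace IsAdjointCubic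

variable {P : MvPolynomial σ K} {n : ℕ}

theorem sum_thirdCoeff (hP : IsAdjointCubic P n) (a : σ) :
    ∑ b, ∑ c, C (thirdCoeff P a b c) * (pderiv b P * pderiv c P) = 2 * (P * X a) := by
  have h : (2 : MvPolynomial σ K) * pderiv a P =
      ∑ b, ∑ c, C (thirdCoeff P a b c) * (X b * X c) := by
    rw [← sum_X_mul_pderiv_pderiv hP.isHomogeneous]
    simp_rw [← sum_X_mul_thirdCoeff hP.isHomogeneous, Finset.mul_sum]
    refine Finset.sum_congr rfl fun b _ => Finset.sum_congr rfl fun c _ => ?_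
    rw [thirdCoeff_swap₂₃, thirdCoeff_swap₁₂, thirdCoeff_swap₂₃, thirdCoeff_swap₂₃ P a]
    ring
  have h2 := congrArg (aeval (fun b => pderiv b P)) h
  rw [map_mul, hP.aeval_pderiv, map_ofNat] at h2
  simpa [algebraMap_eq] using h2.symm

theorem sum_thirdCoeff_pderiv [CharZero K] (hP : IsAdjointCubic P n) (a u : σ) :
    ∑ b, ∑ c, C (thirdCoeff P a b c) * (pderiv u (pderiv b P) * pderiv c P) =
      X a * pderiv u P + if a = u then P else 0 := by
  have h := congrArg (pderiv u) (hP.sum_thirdCoeff a)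
  have hsymm : ∑ b, ∑ c, C (thirdCoeff P a b c) * (pderiv b P * pderiv u (pderiv c P)) =
      ∑ b, ∑ c, C (thirdCoeff P a b c) * (pderiv u (pderiv b P) * pderiv c P) := by
    rw [Finset.sum_comm]
    refine Finset.sum_congr rfl fun b _ => Finset.sum_congr rfl fun c _ => ?_
    rw [thirdCoeff_swap₂₃, mul_comm (pderiv c P)]
  rw [← map_ofNat C 2] at h
  simp only [map_sum, pderiv_C_mul] at h
  simp only [pderiv_mul, mul_add, Finset.sum_add_distrib] at h
  rw [hsymm] at h
  have h2 : (2 : MvPolynomial σ K) ≠ 0 := two_ne_zero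
  apply mul_left_cancel₀ h2
  rw [two_mul, h, map_ofNat]
  rw [pderiv_X, Pi.single_apply, mul_add]
  split_ifs <;> ring

theorem sum_thirdCoeff_pderiv_pderiv_mem [CharZero K] (hP : IsAdjointCubic P n) (a u w : σ) :
    X a * pderiv u (pderiv w P) -
      ∑ b, ∑ c, C (thirdCoeff P a b c) * (pderiv u (pderiv b P) * pderiv w (pderiv c P)) ∈
        gradIdeal P := by
  have h := congrArg (pderiv w) (hP.sum_thirdCoeff_pderiv a u)
  simp only [map_sum, pderiv_C_mul, map_add] at h
  simp only [pderiv_mul, mul_add, Finset.sum_add_distrib] at h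
  rw [pderiv_comm_apply u w]
  have key : X a * pderiv w (pderiv u P) -
      ∑ b, ∑ c, C (thirdCoeff P a b c) * (pderiv u (pderiv b P) * pderiv w (pderiv c P)) =
      ∑ b, ∑ c, C (thirdCoeff P a b c) * (pderiv w (pderiv u (pderiv b P)) * pderiv c P) -
        pderiv w (X a) * pderiv u P - pderiv w (if a = u then P else 0) := by
    linear_combination -h
  rw [key]
  refine sub_mem (sub_mem (sum_mem fun b _ => sum_mem fun c _ => Ideal.mul_mem_left _ _
    (Ideal.mul_mem_left _ _ (pderiv_mem_gradIdeal P c)))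
    (Ideal.mul_mem_left _ _ (pderiv_mem_gradIdeal P u))) ?_
  split_ifs
  · exact pderiv_mem_gradIdeal P w
  · simp

theorem sum_besselCoeff_mul_pderiv_mem [CharZero K] (hP : IsAdjointCubic P n) (u a w : σ) :
    ∑ b, besselCoeff P u a b * pderiv b (pderiv w P) ∈ gradIdeal P := by
  have key : ∑ b, besselCoeff P u a b * pderiv b (pderiv w P) =
      (X a * pderiv u (pderiv w P) - ∑ b, ∑ c, C (thirdCoeff P a b c) *
        (pderiv u (pderiv b P) * pderiv w (pderiv c P))) +
      if a = u then 2 * pderiv w P else 0 := by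
    simp only [besselCoeff, sub_mul, add_mul, Finset.sum_sub_distrib, Finset.sum_add_distrib,
      ite_mul, zero_mul, Finset.sum_ite_eq', Finset.mem_univ, if_true]
    have h1 : ∑ b, (if a = u then X b * pderiv b (pderiv w P) else 0) =
        if a = u then 2 * pderiv w P else 0 := by
      split_ifs
      · exact sum_X_mul_pderiv_pderiv hP.isHomogeneous w
      · simp
    have h2 : ∑ b, (∑ v, pderiv u (pderiv v P) * C (thirdCoeff P v a b)) * pderiv b (pderiv w P) =
        ∑ b, ∑ c, C (thirdCoeff P a b c) *
          (pderiv u (pderiv b P) * pderiv w (pderiv c P)) := by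
      simp_rw [Finset.sum_mul]
      rw [Finset.sum_comm]
      refine Finset.sum_congr rfl fun v _ => Finset.sum_congr rfl fun b _ => ?_
      rw [thirdCoeff_swap₁₂, pderiv_comm_apply b w]
      ring
    rw [h1, h2]
    ring
  rw [key]
  refine add_mem (hP.sum_thirdCoeff_pderiv_pderiv_mem a u w) ?_
  split_ifs
  · exact Ideal.mul_mem_left _ _ (pderiv_mem_gradIdeal P w)
  · exact zero_mem _

theorem bessel_pderiv (hP : IsAdjointCubic P n) (u w : σ) : bessel P n u (pderiv w P) = 0 := by
  have h0 : ∑ a, ∑ b, (∑ v, pderiv u (pderiv v P) * C (thirdCoeff P v a b)) *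
      C (thirdCoeff P a b w) = 2 * ((n : MvPolynomial σ K) + 1) * pderiv u (pderiv w P) := by
    have h1 : ∀ v, ∑ a, ∑ b, pderiv u (pderiv v P) * C (thirdCoeff P v a b) *
        C (thirdCoeff P a b w) =
          if v = w then 2 * ((n : MvPolynomial σ K) + 1) * pderiv u (pderiv w P) else 0 := by
      intro v
      have h2 : ∑ a, ∑ b, pderiv u (pderiv v P) * C (thirdCoeff P v a b) *
        C (thirdCoeff P a b w) = pderiv u (pderiv v P) *
          C (∑ a, ∑ b, thirdCoeff P v a b * thirdCoeff P w a b) := by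
        simp_rw [map_sum, Finset.mul_sum, C_mul]
        refine Finset.sum_congr rfl fun a _ => Finset.sum_congr rfl fun b _ => ?_
        rw [thirdCoeff_swap₂₃ P a b w, thirdCoeff_swap₁₂ P a w b]
        ring
      rw [h2, hP.trace]
      split_ifs with h
      · subst h
        simp only [map_mul, map_add, map_one, map_ofNat, map_natCast]
        ring
      · simp
    simp_rw [Finset.sum_mul]
    calc _ = ∑ v, ∑ a, ∑ b, pderiv u (pderiv v P) * C (thirdCoeff P v a b) *
        C (thirdCoeff P a b w) := by
          symm
          rw [Finset.sum_comm]
          exact Finset.sum_congr rfl fun a _ => Finset.sum_comm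
      _ = _ := by simp [h1]
  simp only [bessel, diffOp, besselCoeff, pderiv_pderiv_pderiv_eq_C hP.isHomogeneous, sub_mul,
    add_mul, Finset.sum_sub_distrib, Finset.sum_add_distrib, ite_mul, zero_mul,
    Finset.sum_ite_eq', Finset.mem_univ, if_true]
  have h1 : ∑ a, ∑ b, (if a = u then X b * C (thirdCoeff P a b w) else 0) =
      pderiv u (pderiv w P) := by
    simp_rw [← sum_X_mul_thirdCoeff hP.isHomogeneous u w, thirdCoeff_swap₁₂ P _ u w]
    rw [Finset.sum_comm]
    simp
  rw [h0, h1, sum_X_mul_thirdCoeff hP.isHomogeneous]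
  ring

theorem bessel_mem [CharZero K] (hP : IsAdjointCubic P n) (u : σ) {f : MvPolynomial σ K}
    (hf : f ∈ gradIdeal P) : bessel P n u f ∈ gradIdeal P :=
  diffOp_mem_span (besselCoeff_symm P u)
    (fun w => by
      have h := hP.bessel_pderiv u w
      rw [bessel] at h
      rw [h]
      exact zero_mem _)
    (fun a w => hP.sum_besselCoeff_mul_pderiv_mem u a w) hf

end IsAdjointCubic

theorem isHomogeneous_bessel {P : MvPolynomial σ K} (hP : P.IsHomogeneous 3) (n : ℕ) (u : σ)
    {f : MvPolynomial σ K} {d : ℕ} (hf : f.IsHomogeneous (d + 1)) :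
    (bessel P n u f).IsHomogeneous d := by
  have hA : ∀ a b, (besselCoeff P u a b).IsHomogeneous 1 := by
    intro a b
    refine Submodule.sub_mem (homogeneousSubmodule σ K 1) (Submodule.add_mem _ ?_ ?_)
      (Submodule.sum_mem _ fun v _ => ?_)
    · split_ifs
      · exact isHomogeneous_X K a
      · exact isHomogeneous_zero _ _ _
    · split_ifs
      · exact isHomogeneous_X K b
      · exact isHomogeneous_zero _ _ _
    · exact (hP.pderiv.pderiv).mul (isHomogeneous_C _ _)
  refine IsHomogeneous.add (IsHomogeneous.sum _ _ _ fun a _ => IsHomogeneous.sum _ _ _ fun b _ => ?_)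
    (IsHomogeneous.sum _ _ _ fun a _ => ?_)
  · rcases d with _ | d
    · have h0 : pderiv a (pderiv b f) = 0 := by
        have : (pderiv b f).IsHomogeneous 0 := hf.pderiv
        rw [← totalDegree_zero_iff_isHomogeneous, totalDegree_eq_zero_iff_eq_C] at this
        rw [this, pderiv_C]
      rw [h0, mul_zero]
      exact isHomogeneous_zero _ _ _
    · have h := (hA a b).mul ((hf.pderiv (i := b)).pderiv (i := a))
      rwa [show 1 + (d + 1 + 1 - 1 - 1) = d + 1 by omega] at h
  · have hc : (if a = u then 2 * (n : MvPolynomial σ K) else 0).IsHomogeneous 0 := by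
      split_ifs
      · have := isHomogeneous_C σ (2 * (n : K))
        rwa [C_mul, map_ofNat, map_natCast] at this
      · exact isHomogeneous_zero _ _ _
    have h := hc.mul (hf.pderiv (i := a))
    rwa [zero_add] at h

theorem sum_X_mul_bessel_mem {P : MvPolynomial σ K} (hP : P.IsHomogeneous 3) (n : ℕ)
    {f : MvPolynomial σ K} {d : ℕ} (hf : f.IsHomogeneous (d + 1)) :
    ∑ u, X u * bessel P n u f - C (2 * ((d : K) + 1) * (d + n)) * f ∈ gradIdeal P := by
  have h1 : ∀ b, ∑ a, X a * pderiv a (pderiv b f) = (d : MvPolynomial σ K) * pderiv b f := by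
    intro b
    rw [hf.pderiv.sum_X_mul_pderiv, nsmul_eq_mul, Nat.add_sub_cancel]
  have h2 : ∑ a, X a * pderiv a f = ((d + 1 : ℕ) : MvPolynomial σ K) * f := by
    rw [hf.sum_X_mul_pderiv, nsmul_eq_mul]
  have key : ∀ u, bessel P n u f = 2 * (((d + n : ℕ) : MvPolynomial σ K) * pderiv u f) -
      ∑ v, pderiv u (pderiv v P) * ∑ a, ∑ b, C (thirdCoeff P v a b) * pderiv a (pderiv b f) := by
    intro u
    have h4 : ∑ a, ∑ b, (if a = u then X b * pderiv a (pderiv b f) else 0) =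
        (d : MvPolynomial σ K) * pderiv u f := by
      rw [← h1, Finset.sum_comm]
      exact Finset.sum_congr rfl fun b _ => by simp [pderiv_comm_apply u b]
    have h5 : ∑ a, ∑ b, (∑ v, pderiv u (pderiv v P) * C (thirdCoeff P v a b)) *
        pderiv a (pderiv b f) =
          ∑ v, pderiv u (pderiv v P) *
            ∑ a, ∑ b, C (thirdCoeff P v a b) * pderiv a (pderiv b f) := by
      simp_rw [Finset.sum_mul, Finset.mul_sum, mul_assoc]
      symm
      rw [Finset.sum_comm]
      exact Finset.sum_congr rfl fun a _ => Finset.sum_comm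
    simp only [bessel, diffOp, besselCoeff, sub_mul, add_mul, Finset.sum_sub_distrib,
      Finset.sum_add_distrib, ite_mul, zero_mul, Finset.sum_ite_eq', Finset.mem_univ, if_true]
    rw [h4, h5, h1]
    push_cast
    ring
  have h3 : ∑ u, X u * bessel P n u f - C (2 * ((d : K) + 1) * (d + n)) * f =
      - ∑ v, (∑ u, X u * pderiv u (pderiv v P)) *
        ∑ a, ∑ b, C (thirdCoeff P v a b) * pderiv a (pderiv b f) := by
    simp_rw [key, mul_sub, Finset.sum_sub_distrib, Finset.sum_mul]
    have h6 : ∑ u, X u * (2 * (((d + n : ℕ) : MvPolynomial σ K) * pderiv u f)) =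
        C (2 * ((d : K) + 1) * (d + n)) * f := by
      simp_rw [mul_left_comm (X _)]
      rw [← Finset.mul_sum, ← Finset.mul_sum, h2]
      simp only [map_mul, map_add, map_one, map_ofNat, map_natCast]
      push_cast
      ring
    rw [h6, Finset.sum_comm]
    simp_rw [Finset.mul_sum, mul_assoc]
    rw [Finset.sum_comm]
    ring
  rw [h3]
  refine neg_mem (sum_mem fun v _ => Ideal.mul_mem_right _ _ ?_)
  rw [sum_X_mul_pderiv_pderiv hP]
  exact Ideal.mul_mem_left _ _ (pderiv_mem_gradIdeal P v)

end Cubic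

section Saturation

attribute [local instance] MvPolynomial.gradedAlgebra

theorem homogeneousComponent_mul_of_isHomogeneous {σ R : Type*} [CommSemiring R]
    {p : MvPolynomial σ R} {k : ℕ} (hp : p.IsHomogeneous k) (f : MvPolynomial σ R) (d : ℕ) :
    homogeneousComponent (k + d) (p * f) = p * homogeneousComponent d f := by
  have h : ∀ i, homogeneousComponent (k + d) (p * homogeneousComponent i f) =
      if i = d then p * homogeneousComponent i f else 0 := fun i => by
    have hmem : p * homogeneousComponent i f ∈ homogeneousSubmodule σ R (k + i) :=
      hp.mul (homogeneousComponent_isHomogeneous i f)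
    rw [homogeneousComponent_of_mem hmem]
    simp [eq_comm]
  conv_lhs => rw [← sum_homogeneousComponent f, Finset.mul_sum, map_sum]
  simp_rw [h]
  rw [Finset.sum_ite_eq']
  split_ifs with hd
  · rfl
  · rw [homogeneousComponent_eq_zero _ _ (by rw [Finset.mem_range] at hd; omega), mul_zero]

variable {σ K : Type*} [Field K]

theorem isHomogeneous_gradIdeal {P : MvPolynomial σ K} (hP : P.IsHomogeneous 3) :
    (gradIdeal P).IsHomogeneous (homogeneousSubmodule σ K) := by
  refine Ideal.homogeneous_span _ _ ?_
  rintro _ ⟨v, rfl⟩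
  exact ⟨2, hP.pderiv⟩

/-- The ideal of partial derivatives of an adjoint cubic is saturated with respect to any variable
which is not nilpotent modulo it. -/
theorem IsAdjointCubic.mem_of_pow_mul_mem [Fintype σ] [DecidableEq σ] [CharZero K]
    {P : MvPolynomial σ K} {n : ℕ} (hP : IsAdjointCubic P n) (hn : 0 < n) {t : σ}
    (ht : ∀ k, X t ^ k ∉ gradIdeal P)
    {f : MvPolynomial σ K} {k : ℕ} (hf : X t ^ k * f ∈ gradIdeal P) : f ∈ gradIdeal P := by
  have hom : ∀ (d : ℕ) (g : MvPolynomial σ K) (k : ℕ), g.IsHomogeneous d →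
      X t ^ k * g ∈ gradIdeal P → g ∈ gradIdeal P := by
    intro d
    induction d with
    | zero =>
      intro g k hg hgk
      rw [← totalDegree_zero_iff_isHomogeneous, totalDegree_eq_zero_iff_eq_C] at hg
      by_cases h0 : coeff 0 g = 0
      · rw [hg, h0, C_0]
        exact zero_mem _
      · refine absurd ?_ (ht k)
        have h1 := Ideal.mul_mem_right (C (coeff 0 g)⁻¹) _ hgk
        rwa [hg, mul_assoc, ← C_mul, coeff_zero_C, mul_inv_cancel₀ h0, C_1, mul_one] at h1
    | succ d ih =>
      intro g k hg hgk
      have h1 : ∀ u, bessel P n u g ∈ gradIdeal P := fun u =>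
        ih _ (k + 2) (isHomogeneous_bessel hP.isHomogeneous n u hg)
          (diffOp_pow_mul_mem (besselCoeff_symm P u) (fun f hf => hP.bessel_mem u hf) k g hgk)
      have h2 := sub_mem (sum_mem fun u (_ : u ∈ Finset.univ) =>
        Ideal.mul_mem_left _ (X u) (h1 u)) (sum_X_mul_bessel_mem hP.isHomogeneous n hg)
      rw [sub_sub_cancel] at h2
      have h0 : 2 * ((d : K) + 1) * (d + n) ≠ 0 := by
        have : d + n ≠ 0 := by omega
        exact_mod_cast mul_ne_zero (mul_ne_zero two_ne_zero d.succ_ne_zero) this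
      have h3 := Ideal.mul_mem_left _ (C (2 * ((d : K) + 1) * (d + n))⁻¹) h2
      rwa [← mul_assoc, ← C_mul, inv_mul_cancel₀ h0, C_1, one_mul] at h3
  rw [mem_iff_homogeneousComponent_mem (isHomogeneous_gradIdeal hP.isHomogeneous)]
  intro d
  refine hom d _ k (homogeneousComponent_isHomogeneous d f) ?_
  rw [← homogeneousComponent_mul_of_isHomogeneous (by simpa using (isHomogeneous_X K t).pow k)]
  exact homogeneousComponent_mem_of_mem (isHomogeneous_gradIdeal hP.isHomogeneous) hf _

end Saturation

section Elimination

variable {σ K : Type*} [Field K]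

/-- The ideal generated by the elements `X t * X s + q s` with `s ∈ S`. -/
def elimIdeal (t : σ) (q : σ → MvPolynomial σ K) (S : Finset σ) : Ideal (MvPolynomial σ K) :=
  Ideal.span ((fun s => X t * X s + q s) '' S)

/-- The substitution solving the equations `X t * X s + q s = 0` for `s ∈ S`. -/
def elimHom [DecidableEq σ] (t : σ) (q : σ → MvPolynomial σ K) (S : Finset σ) :
    MvPolynomial σ K →ₐ[K] FractionRing (MvPolynomial σ K) :=
  aeval fun s =>
    if s ∈ S then
      -algebraMap (MvPolynomial σ K) (FractionRing (MvPolynomial σ K)) (q s) /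
        algebraMap (MvPolynomial σ K) (FractionRing (MvPolynomial σ K)) (X t)
    else algebraMap (MvPolynomial σ K) (FractionRing (MvPolynomial σ K)) (X s)

variable {t : σ} {q : σ → MvPolynomial σ K} {S : Finset σ}

theorem algebraMap_X_ne_zero :
    algebraMap (MvPolynomial σ K) (FractionRing (MvPolynomial σ K)) (X t) ≠ 0 := by
  simp [X_ne_zero]

variable [DecidableEq σ]

theorem elimHom_eq_algebraMap {g : MvPolynomial σ K}
    (hg : g ∈ supported K ((S : Set σ)ᶜ)) :
    elimHom t q S g = algebraMap (MvPolynomial σ K) (FractionRing (MvPolynomial σ K)) g := by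
  induction hg using Algebra.adjoin_induction with
  | mem x hx =>
    obtain ⟨s, hs, rfl⟩ := hx
    rw [elimHom, aeval_X, if_neg (by simpa using hs)]
  | algebraMap r => rw [AlgHom.commutes, ← IsScalarTower.algebraMap_apply]
  | add x y _ _ hx hy => rw [map_add, map_add, hx, hy]
  | mul x y _ _ hx hy => rw [map_mul, map_mul, hx, hy]

variable (ht : t ∉ S) (hq : ∀ s ∈ S, q s ∈ supported K ((S : Set σ)ᶜ))

include ht in
theorem elimHom_X_self : elimHom t q S (X t) =
    algebraMap (MvPolynomial σ K) (FractionRing (MvPolynomial σ K)) (X t) :=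
  elimHom_eq_algebraMap (X_mem_supported.mpr (by simpa using ht))

include ht hq in
theorem elimIdeal_le_ker : elimIdeal t q S ≤ RingHom.ker (elimHom t q S) := by
  refine Ideal.span_le.mpr ?_
  rintro _ ⟨s, hs, rfl⟩
  have hs' : s ∈ S := hs
  rw [SetLike.mem_coe, RingHom.mem_ker, map_add, map_mul, elimHom_X_self ht,
    elimHom_eq_algebraMap (hq s hs), elimHom, aeval_X, if_pos hs',
    mul_div_cancel₀ _ algebraMap_X_ne_zero, neg_add_cancel]

include ht hq in
theorem exists_supported_sub_mem (f : MvPolynomial σ K) : ∃ k, ∃ g ∈ supported K ((S : Set σ)ᶜ),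
    X t ^ k * f - g ∈ elimIdeal t q S := by
  have hX : ∀ k, (X t : MvPolynomial σ K) ^ k ∈ supported K ((S : Set σ)ᶜ) := fun k =>
    pow_mem (X_mem_supported.mpr (by simpa using ht)) k
  induction f using MvPolynomial.induction_on with
  | C a => exact ⟨0, C a, Subalgebra.algebraMap_mem _ a, by simp⟩
  | add f₁ f₂ h₁ h₂ =>
    obtain ⟨k₁, g₁, hg₁, h₁⟩ := h₁
    obtain ⟨k₂, g₂, hg₂, h₂⟩ := h₂
    refine ⟨k₁ + k₂, X t ^ k₂ * g₁ + X t ^ k₁ * g₂,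
      add_mem (mul_mem (hX _) hg₁) (mul_mem (hX _) hg₂), ?_⟩
    convert add_mem (Ideal.mul_mem_left _ (X t ^ k₂) h₁) (Ideal.mul_mem_left _ (X t ^ k₁) h₂)
      using 1
    ring
  | mul_X f s h =>
    obtain ⟨k, g, hg, h⟩ := h
    by_cases hs : s ∈ S
    · refine ⟨k + 1, -(g * q s), neg_mem (mul_mem hg (hq s hs)), ?_⟩
      have h2 : X t * X s + q s ∈ elimIdeal t q S := Ideal.subset_span ⟨s, hs, rfl⟩
      convert add_mem (Ideal.mul_mem_left _ (X t * X s) h) (Ideal.mul_mem_left _ g h2) using 1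
      ring
    · refine ⟨k, g * X s, mul_mem hg (X_mem_supported.mpr (by simpa using hs)), ?_⟩
      convert Ideal.mul_mem_left _ (X s) h using 1
      ring

include ht hq in
theorem mem_ker_elimHom_iff (f : MvPolynomial σ K) :
    f ∈ RingHom.ker (elimHom t q S) ↔ ∃ k, X t ^ k * f ∈ elimIdeal t q S := by
  constructor
  · intro hf
    obtain ⟨k, g, hg, h⟩ := exists_supported_sub_mem ht hq f
    have h0 : elimHom t q S g = 0 := by
      have h1 := elimIdeal_le_ker ht hq h
      rw [RingHom.mem_ker, map_sub, map_mul, RingHom.mem_ker.mp hf, mul_zero, zero_sub,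
        neg_eq_zero] at h1
      exact h1
    rw [elimHom_eq_algebraMap hg] at h0
    have hg0 : g = 0 := by simpa using h0
    exact ⟨k, by simpa [hg0] using h⟩
  · rintro ⟨k, hk⟩
    have h := elimIdeal_le_ker ht hq hk
    rw [RingHom.mem_ker, map_mul, map_pow, elimHom_X_self ht] at h
    exact (mul_eq_zero.mp h).resolve_left (pow_ne_zero _ algebraMap_X_ne_zero)

include ht hq in
theorem height_ker_elimHom_le [Finite σ] :
    (RingHom.ker (elimHom t q S)).height ≤ S.card := by
  have hmin : RingHom.ker (elimHom t q S) ∈ (elimIdeal t q S).minimalPrimes := by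
    refine ⟨⟨RingHom.ker_isPrime _, elimIdeal_le_ker ht hq⟩, fun Q hQ hQle f hf => ?_⟩
    obtain ⟨k, hk⟩ := (mem_ker_elimHom_iff ht hq f).mp hf
    refine (hQ.1.mem_or_mem (hQ.2 hk)).resolve_left fun h => ?_
    have h1 := hQle (hQ.1.mem_of_pow_mem _ h)
    rw [RingHom.mem_ker, elimHom_X_self ht] at h1
    exact algebraMap_X_ne_zero h1
  refine (Ideal.height_le_card_of_mem_minimalPrimes_span (S.finite_toSet.image _) hmin).trans ?_
  exact_mod_cast (Set.ncard_image_le S.finite_toSet).trans (Set.ncard_coe_finset S).le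

include ht hq in
theorem le_height_ker_elimHom : S.card ≤ (RingHom.ker (elimHom t q S)).height := by
  induction S using Finset.induction_on with
  | empty => simp
  | insert s S hs ih =>
    have hsub : ((insert s S : Finset σ) : Set σ)ᶜ ⊆ (S : Set σ)ᶜ := by
      simp
    have ht' : t ∉ S := fun h => ht (Finset.mem_insert_of_mem h)
    have hq' : ∀ r ∈ S, q r ∈ supported K ((S : Set σ)ᶜ) := fun r hr =>
      supported_mono hsub (hq r (Finset.mem_insert_of_mem hr))
    have hprime : ∀ T : Finset σ, (RingHom.ker (elimHom t q T)).IsPrime := fun T =>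
      RingHom.ker_isPrime _
    have := hprime S
    have := hprime (insert s S)
    have hs_mem : X t * X s + q s ∈ RingHom.ker (elimHom t q (insert s S)) :=
      elimIdeal_le_ker ht hq (Ideal.subset_span ⟨s, by simp, rfl⟩)
    have hs_notMem : X t * X s + q s ∉ RingHom.ker (elimHom t q S) := by
      have hqs := hq s (Finset.mem_insert_self s S)
      rw [RingHom.mem_ker, elimHom_eq_algebraMap (add_mem (mul_mem
        (X_mem_supported.mpr (by simpa using ht')) (X_mem_supported.mpr (by simpa using hs)))
        (supported_mono hsub hqs))]
      simp only [FaithfulSMul.algebraMap_eq_zero_iff]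
      intro h0
      have hs0 : pderiv s (q s) = 0 := pderiv_eq_zero_of_notMem_vars fun h =>
        absurd (mem_supported.mp hqs h) (by simp)
      have hst : t ≠ s := fun h => ht (h ▸ Finset.mem_insert_self s S)
      have h1 := congrArg (pderiv s) h0
      rw [map_add, pderiv_mul, pderiv_X_of_ne hst, pderiv_X_self, hs0, map_zero] at h1
      simp [X_ne_zero] at h1
    have hlt : RingHom.ker (elimHom t q S) < RingHom.ker (elimHom t q (insert s S)) := by
      refine lt_of_le_of_ne (fun f hf => ?_) fun h => hs_notMem (h ▸ hs_mem)
      obtain ⟨k, hk⟩ := (mem_ker_elimHom_iff ht' hq' f).mp hf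
      exact (mem_ker_elimHom_iff ht hq f).mpr ⟨k, Ideal.span_mono
        (Set.image_mono (by simp)) hk⟩
    rw [Finset.card_insert_of_notMem hs, Nat.cast_add, Nat.cast_one]
    exact (add_le_add_left (ih ht' hq') 1).trans (Ideal.height_add_one_le_of_lt_of_isPrime hlt)

end Elimination

section E6

variable (K : Type*) [Field K]

/-- The Pfaffian of a `4 × 4` principal submatrix of `Z`. -/
def pfMinor (a b c d : Fin 6) : MvPolynomial E6Var K :=
  zv K a b * zv K c d - zv K a c * zv K b d + zv K a d * zv K b c

/-- The partial derivatives of the Pfaffian. -/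
def pfGrad : Matrix (Fin 6) (Fin 6) (MvPolynomial E6Var K) :=
  !![0, pfMinor K 2 3 4 5, -pfMinor K 1 3 4 5, pfMinor K 1 2 4 5, -pfMinor K 1 2 3 5,
      pfMinor K 1 2 3 4;
    0, 0, pfMinor K 0 3 4 5, -pfMinor K 0 2 4 5, pfMinor K 0 2 3 5, -pfMinor K 0 2 3 4;
    0, 0, 0, pfMinor K 0 1 4 5, -pfMinor K 0 1 3 5, pfMinor K 0 1 3 4;
    0, 0, 0, 0, pfMinor K 0 1 2 5, -pfMinor K 0 1 2 4;
    0, 0, 0, 0, 0, pfMinor K 0 1 2 3;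
    0, 0, 0, 0, 0, 0]

/-- The partial derivatives of the cubic invariant. -/
def cubicGrad : E6Var → MvPolynomial E6Var K
  | .inl i => ∑ j, zv K i j * yv K j
  | .inr (.inl j) => ∑ i, zv K i j * xv K i
  | .inr (.inr ⟨(i, j), _⟩) => xv K i * yv K j - xv K j * yv K i + pfGrad K i j

theorem cubicP_eq : cubicP K = pfZ K + ∑ i, ∑ j, zv K i j * xv K i * yv K j := by
  rw [cubicP, add_right_inj]
  refine Finset.sum_congr rfl fun i _ => Finset.sum_congr rfl fun j _ => ?_
  split_ifs with h
  · simp [h, zv]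
  · rfl

theorem pderiv_inl_xv (i j : Fin 6) :
    pderiv (Sum.inl i) (xv K j) = if j = i then 1 else 0 := by
  simp [xv, pderiv_X, Pi.single_apply]

theorem pderiv_inl_yv (i j : Fin 6) : pderiv (Sum.inl i) (yv K j) = 0 := by
  simp [yv, pderiv_X]

theorem pderiv_inl_zv (i j k : Fin 6) : pderiv (Sum.inl i) (zv K j k) = 0 := by
  unfold zv
  split_ifs <;> simp [pderiv_X]

theorem pderiv_inr_xv (i j) : pderiv (Sum.inr i) (xv K j) = 0 := by
  simp [xv, pderiv_X]

theorem pderiv_inr_inl_yv (i j : Fin 6) :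
    pderiv (Sum.inr (Sum.inl i)) (yv K j) = if j = i then 1 else 0 := by
  simp [yv, pderiv_X, Pi.single_apply]

theorem pderiv_inr_inl_zv (i j k : Fin 6) : pderiv (Sum.inr (Sum.inl i)) (zv K j k) = 0 := by
  unfold zv
  split_ifs <;> simp [pderiv_X]

theorem pderiv_inr_inr_yv (i j) : pderiv (Sum.inr (Sum.inr i)) (yv K j) = 0 := by
  simp [yv, pderiv_X]

theorem pderiv_inr_inr_zv (i j : Fin 6) (h : i < j) (k l : Fin 6) :
    pderiv (Sum.inr (Sum.inr ⟨(i, j), h⟩)) (zv K k l) =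
      (if i = k then if j = l then 1 else 0 else 0) -
        if i = l then if j = k then 1 else 0 else 0 := by
  unfold zv
  split_ifs <;> simp_all [pderiv_X] <;> omega

theorem pderiv_inr_inr_pfZ (i j : Fin 6) (h : i < j) :
    pderiv (Sum.inr (Sum.inr ⟨(i, j), h⟩)) (pfZ K) = pfGrad K i j := by
  fin_cases i <;> fin_cases j <;> first | exact absurd h (by decide) | skip
  all_goals simp [pfZ, pderiv_inr_inr_zv, pfGrad, pfMinor]
  all_goals try ring

theorem pderiv_cubicP (v : E6Var) : pderiv v (cubicP K) = cubicGrad K v := by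
  rw [cubicP_eq]
  rcases v with i | i | ⟨⟨i, j⟩, h⟩
  · simp [cubicGrad, pfZ, pderiv_inl_xv, pderiv_inl_yv, pderiv_inl_zv, mul_comm]
  · simp [cubicGrad, pfZ, pderiv_inr_inl_yv, pderiv_inr_xv, pderiv_inr_inl_zv, mul_comm]
  · simp [cubicGrad, pderiv_inr_inr_pfZ, pderiv_inr_inr_yv, pderiv_inr_xv, pderiv_inr_inr_zv, mul_sub,
      Finset.sum_sub_distrib]
    ring

set_option maxHeartbeats 2000000 in
theorem aeval_cubicGrad (v : E6Var) :
    aeval (cubicGrad K) (cubicGrad K v) = cubicP K * X v := by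
  rw [cubicP_eq]
  rcases v with i | i | ⟨⟨i, j⟩, h⟩
  · fin_cases i <;>
    simp [cubicGrad, pfZ, Fin.sum_univ_six, zv, xv, yv, pfGrad, pfMinor] <;> ring
  · fin_cases i <;>
    simp [cubicGrad, pfZ, Fin.sum_univ_six, zv, xv, yv, pfGrad, pfMinor] <;> ring
  · fin_cases i <;> fin_cases j <;> first | exact absurd h (by decide) | skip
    all_goals
      simp [cubicGrad, pfZ, Fin.sum_univ_six, zv, xv, yv, pfGrad, pfMinor]
      ring

theorem isWeightedHomogeneous_zv {M : Type*} [AddCommMonoid M] {w : E6Var → M} {c : M}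
    {e : Fin 6 → M} (hz : ∀ p, w (.inr (.inr p)) = c + e p.1.1 + e p.1.2) (i j : Fin 6) :
    IsWeightedHomogeneous w (zv K i j) (c + e i + e j) := by
  unfold zv
  split_ifs with h h
  · rw [← hz ⟨(i, j), h⟩]
    exact isWeightedHomogeneous_X K w _
  · rw [add_right_comm, ← hz ⟨(j, i), h⟩]
    exact Submodule.neg_mem (weightedHomogeneousSubmodule K w _) (isWeightedHomogeneous_X K w _)
  · exact isWeightedHomogeneous_zero K w _

theorem isWeightedHomogeneous_pfZ {M : Type*} [AddCommMonoid M] {w : E6Var → M} {c : M}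
    {e : Fin 6 → M} (hz : ∀ p, w (.inr (.inr p)) = c + e p.1.1 + e p.1.2) :
    IsWeightedHomogeneous w (pfZ K) (3 • c + ∑ i, e i) := by
  have h : ∀ i j k l m n : Fin 6, e i + e j + e k + e l + e m + e n = ∑ i, e i →
      zv K i j * zv K k l * zv K m n ∈
        weightedHomogeneousSubmodule K w (3 • c + ∑ i, e i) := by
    intro i j k l m n he
    have := ((isWeightedHomogeneous_zv K hz i j).mul (isWeightedHomogeneous_zv K hz k l)).mul
      (isWeightedHomogeneous_zv K hz m n)
    rw [mem_weightedHomogeneousSubmodule, ← he]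
    convert this using 1
    abel
  rw [← mem_weightedHomogeneousSubmodule, pfZ]
  repeat' first
    | apply Submodule.add_mem
    | apply Submodule.sub_mem
  all_goals
    refine h _ _ _ _ _ _ ?_
    rw [Fin.sum_univ_six]
  all_goals abel

theorem isWeightedHomogeneous_cubicP {M : Type*} [AddCommMonoid M] {w : E6Var → M} {a b c : M}
    {e : Fin 6 → M} (hx : ∀ i, w (.inl i) + e i = a) (hy : ∀ j, w (.inr (.inl j)) + e j = b)
    (hz : ∀ p, w (.inr (.inr p)) = c + e p.1.1 + e p.1.2)
    (h : a + b + c = 3 • c + ∑ i, e i) : IsWeightedHomogeneous w (cubicP K) (a + b + c) := by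
  rw [cubicP_eq]
  refine IsWeightedHomogeneous.add (h ▸ isWeightedHomogeneous_pfZ K hz)
    (IsWeightedHomogeneous.sum _ _ _ fun i _ => IsWeightedHomogeneous.sum _ _ _ fun j _ => ?_)
  convert ((isWeightedHomogeneous_zv K hz i j).mul (isWeightedHomogeneous_X K w (.inl i))).mul
    (isWeightedHomogeneous_X K w (.inr (.inl j))) using 1
  · rfl
  rw [← hx i, ← hy j]
  abel

theorem isHomogeneous_cubicP : (cubicP K).IsHomogeneous 3 :=
  isWeightedHomogeneous_cubicP K (w := 1) (a := 1) (b := 1) (c := 1) (e := 0)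
    (by simp) (by simp) (by simp) (by simp)

/-- A weight for the action of a maximal torus of `E₆`, generic enough to separate the variables. -/
def e6Weight : E6Var → ℤ
  | .inl i => 1000 - 2 ^ i.val
  | .inr (.inl j) => -979 - 2 ^ j.val
  | .inr (.inr p) => -21 + 2 ^ p.1.1.val + 2 ^ p.1.2.val

theorem e6Weight_injective : Function.Injective e6Weight := by
  decide +kernel

theorem e6Weight_add_eq_zero {u v w : E6Var} (h : thirdCoeff (cubicP K) u v w ≠ 0) :
    e6Weight u + e6Weight v + e6Weight w = 0 := by
  have h0 : IsWeightedHomogeneous e6Weight (cubicP K) (1000 + -979 + -21) :=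
    isWeightedHomogeneous_cubicP K (e := fun i => 2 ^ i.val)
    (by simp [e6Weight]) (by simp [e6Weight]) (by simp [e6Weight]) (by decide)
  have h1 : IsWeightedHomogeneous e6Weight (pderiv u (pderiv v (pderiv w (cubicP K))))
      (-e6Weight w - e6Weight v - e6Weight u) :=
    ((h0.pderiv (n' := -e6Weight w) (by ring)).pderiv (n' := -e6Weight w - e6Weight v)
      (by ring)).pderiv (by ring)
  have h2 := h1 h
  rw [Finsupp.weight_apply, Finsupp.sum_zero_index] at h2
  linarith

set_option maxHeartbeats 1000000 in
theorem trace_cubicP (v w : E6Var) :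
    ∑ a, ∑ b, thirdCoeff (cubicP K) v a b * thirdCoeff (cubicP K) w a b =
      if v = w then 2 * (((4 : ℕ) : K) + 1) else 0 := by
  split_ifs with h
  · subst h
    have key : ∑ a, ∑ b, thirdCoeff (cubicP K) v a b * thirdCoeff (cubicP K) v a b =
        contract (fun a b => thirdCoeff (cubicP K) v a b) (cubicGrad K v) := by
      rw [contract_apply, ← pderiv_cubicP]
      refine Finset.sum_congr rfl fun a _ => Finset.sum_congr rfl fun b _ => ?_
      rw [thirdCoeff_swap₁₂, thirdCoeff_swap₂₃]
      rfl
    rw [key]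
    simp_rw [thirdCoeff, pderiv_cubicP]
    rcases v with i | i | ⟨⟨i, j⟩, h⟩
    · fin_cases i <;>
      simp [cubicGrad, Fin.sum_univ_six, zv, xv, yv, contract_X_mul_X, pderiv_X, pfGrad,
        pfMinor] <;> norm_num
    · fin_cases i <;>
      simp [cubicGrad, Fin.sum_univ_six, zv, xv, yv, contract_X_mul_X, pderiv_X, pfGrad,
        pfMinor] <;> norm_num
    · fin_cases i <;> fin_cases j <;> first | exact absurd h (by decide) | skip
      all_goals simp [cubicGrad, Fin.sum_univ_six, zv, xv, yv, contract_X_mul_X, pderiv_X, pfGrad,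
        pfMinor]
      all_goals norm_num
  · refine Finset.sum_eq_zero fun a _ => Finset.sum_eq_zero fun b _ => ?_
    contrapose! h
    have h1 := e6Weight_add_eq_zero K (left_ne_zero_of_mul h)
    have h2 := e6Weight_add_eq_zero K (right_ne_zero_of_mul h)
    exact e6Weight_injective (by linarith)

theorem isAdjointCubic_cubicP : IsAdjointCubic (cubicP K) 4 where
  isHomogeneous := isHomogeneous_cubicP K
  aeval_pderiv a := by simpa only [pderiv_cubicP] using aeval_cubicGrad K a
  trace := trace_cubicP K

/-- Whether a variable is one of the `y_j` or `z_{1j}` with `j ≠ 1`. -/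
def isElimVar : E6Var → Bool
  | .inl _ => false
  | .inr (.inl j) => j ≠ 0
  | .inr (.inr p) => p.1.1 = 0

/-- The ten variables that the gradient determines rationally in terms of the others. -/
def elimVars : Finset E6Var :=
  Finset.univ.filter fun v => isElimVar v

/-- The involution of `elimVars` exchanging `y_j` and `z_{1j}`. -/
def partner : E6Var → E6Var
  | .inl i => .inl i
  | .inr (.inl j) => if h : 0 < j then .inr (.inr ⟨(0, j), h⟩) else .inr (.inl j)
  | .inr (.inr p) => .inr (.inl p.1.2)

theorem card_elimVars : elimVars.card = 10 := by
  decide +kernel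

theorem partner_mem_elimVars : ∀ v ∈ elimVars, partner v ∈ elimVars ∧ partner (partner v) = v := by
  decide +kernel

/-- The part of a partial derivative which does not involve the eliminated variables. -/
def elimRest (v : E6Var) : MvPolynomial E6Var K :=
  cubicGrad K (partner v) - X (.inl 0) * X v

theorem X_mem_supported_compl_elimVars {v : E6Var} (hv : isElimVar v = false) :
    X v ∈ supported K ((elimVars : Set E6Var)ᶜ) :=
  X_mem_supported.mpr (by simp [elimVars, hv])

theorem zv_mem_supported {i j : Fin 6} (hi : i ≠ 0) (hj : j ≠ 0) :
    zv K i j ∈ supported K ((elimVars : Set E6Var)ᶜ) := by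
  unfold zv
  split_ifs
  · exact X_mem_supported_compl_elimVars K (by simp [isElimVar, hi])
  · exact neg_mem (X_mem_supported_compl_elimVars K (by simp [isElimVar, hj]))
  · exact zero_mem _

theorem pfMinor_mem_supported {i j k l : Fin 6} (hi : i ≠ 0) (hj : j ≠ 0) (hk : k ≠ 0)
    (hl : l ≠ 0) : pfMinor K i j k l ∈ supported K ((elimVars : Set E6Var)ᶜ) :=
  add_mem (sub_mem (mul_mem (zv_mem_supported K hi hj) (zv_mem_supported K hk hl))
    (mul_mem (zv_mem_supported K hi hk) (zv_mem_supported K hj hl)))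
    (mul_mem (zv_mem_supported K hi hl) (zv_mem_supported K hj hk))

theorem pfGrad_zero_mem_supported (j : Fin 6) :
    pfGrad K 0 j ∈ supported K ((elimVars : Set E6Var)ᶜ) := by
  fin_cases j
  · exact zero_mem _
  · exact pfMinor_mem_supported K (by decide) (by decide) (by decide) (by decide)
  · exact neg_mem (pfMinor_mem_supported K (by decide) (by decide) (by decide) (by decide))
  · exact pfMinor_mem_supported K (by decide) (by decide) (by decide) (by decide)
  · exact neg_mem (pfMinor_mem_supported K (by decide) (by decide) (by decide) (by decide))
  · exact pfMinor_mem_supported K (by decide) (by decide) (by decide) (by decide)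

theorem elimRest_mem_supported {v : E6Var} (hv : v ∈ elimVars) :
    elimRest K v ∈ supported K ((elimVars : Set E6Var)ᶜ) := by
  rcases v with i | j | ⟨⟨i, j⟩, h⟩
  · simp [elimVars, isElimVar] at hv
  · have hj : 0 < j := Fin.pos_iff_ne_zero.mpr (by simpa [elimVars, isElimVar] using hv)
    have key : elimRest K (.inr (.inl j)) =
        pfGrad K 0 j - X (.inl j) * X (.inr (.inl 0)) := by
      simp only [elimRest, partner, dif_pos hj, cubicGrad, xv, yv]
      ring
    rw [key]
    exact sub_mem (pfGrad_zero_mem_supported K j) (mul_mem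
      (X_mem_supported_compl_elimVars K rfl) (X_mem_supported_compl_elimVars K rfl))
  · obtain rfl : i = 0 := by simpa [elimVars, isElimVar] using hv
    have hz : zv K 0 j = X (.inr (.inr ⟨(0, j), h⟩)) := dif_pos h
    simp only [elimRest, partner, cubicGrad]
    rw [Fin.sum_univ_succ, hz, xv, mul_comm (X (Sum.inl 0)), add_sub_cancel_left]
    exact sum_mem fun i _ => mul_mem (zv_mem_supported K i.succ_ne_zero
      (Fin.pos_iff_ne_zero.mp h)) (X_mem_supported_compl_elimVars K rfl)

theorem pderiv_cubicGrad_inl_zero {v : E6Var} (hv : v ∉ elimVars) :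
    pderiv v (cubicGrad K (.inl 0)) = 0 := by
  rcases v with i | i | ⟨⟨i, j⟩, h⟩
  · simp [cubicGrad, pderiv_inl_yv, pderiv_inl_zv]
  · obtain rfl : i = 0 := by simpa [elimVars, isElimVar] using hv
    simp [cubicGrad, pderiv_inr_inl_yv, pderiv_inr_inl_zv]
    simp [zv]
  · have hi : i ≠ 0 := by simpa [elimVars, isElimVar] using hv
    have hj : j ≠ 0 := fun hj => by simp [hj] at h
    simp [cubicGrad, pderiv_inr_inr_yv, pderiv_inr_inr_zv, hi, hj]

theorem mem_elimVars_of_thirdCoeff_ne_zero {b c : E6Var}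
    (h : thirdCoeff (cubicP K) (.inl 0) b c ≠ 0) : c ∈ elimVars := by
  contrapose! h
  rw [thirdCoeff_swap₁₂, thirdCoeff_swap₂₃, thirdCoeff, pderiv_cubicP,
    pderiv_cubicGrad_inl_zero K h, map_zero, map_zero]

theorem inl_zero_notMem_elimVars : Sum.inl 0 ∉ elimVars := by
  simp [elimVars, isElimVar]

theorem pderiv_cubicP_mem_elimIdeal {v : E6Var} (hv : v ∈ elimVars) :
    pderiv v (cubicP K) ∈ elimIdeal (.inl 0) (elimRest K) elimVars := by
  obtain ⟨h1, h2⟩ := partner_mem_elimVars v hv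
  refine Ideal.subset_span ⟨partner v, h1, ?_⟩
  simp [elimRest, h2, pderiv_cubicP]

theorem elimIdeal_le_gradIdeal :
    elimIdeal (.inl 0) (elimRest K) elimVars ≤ gradIdeal (cubicP K) := by
  refine Ideal.span_le.mpr ?_
  rintro _ ⟨v, -, rfl⟩
  simpa [elimRest, ← pderiv_cubicP] using pderiv_mem_gradIdeal (cubicP K) (partner v)

theorem gradIdeal_eq_ker_elimHom [CharZero K] :
    gradIdeal (cubicP K) = RingHom.ker (elimHom (.inl 0) (elimRest K) elimVars) := by
  have ht := inl_zero_notMem_elimVars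
  have hq : ∀ v ∈ elimVars, elimRest K v ∈ supported K ((elimVars : Set E6Var)ᶜ) :=
    fun v hv => elimRest_mem_supported K hv
  have : (RingHom.ker (elimHom (.inl 0) (elimRest K) elimVars)).IsPrime := RingHom.ker_isPrime _
  set J := RingHom.ker (elimHom (.inl 0) (elimRest K) elimVars) with hJ
  have hXt : X (.inl 0) ∉ J := by
    rw [hJ, RingHom.mem_ker, elimHom_X_self ht]
    exact algebraMap_X_ne_zero
  have hsum : ∀ u, X (.inl 0) * pderiv u (cubicP K) + (if .inl 0 = u then cubicP K else 0) ∈ J := by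
    intro u
    rw [← (isAdjointCubic_cubicP K).sum_thirdCoeff_pderiv]
    refine sum_mem fun b _ => sum_mem fun c _ => ?_
    by_cases h : thirdCoeff (cubicP K) (.inl 0) b c = 0
    · simp [h]
    · exact Ideal.mul_mem_left _ _ (Ideal.mul_mem_left _ _ (elimIdeal_le_ker ht hq
        (pderiv_cubicP_mem_elimIdeal K (mem_elimVars_of_thirdCoeff_ne_zero K h))))
  have hne : ∀ u, u ≠ .inl 0 → pderiv u (cubicP K) ∈ J := by
    intro u hu
    have h := hsum u
    rw [if_neg (Ne.symm hu), add_zero] at h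
    exact (this.mem_or_mem h).resolve_left hXt
  have hle : gradIdeal (cubicP K) ≤ J := by
    refine Ideal.span_le.mpr ?_
    rintro _ ⟨u, rfl⟩
    by_cases hu : u = .inl 0
    · subst hu
      have h1 := hsum (.inl 0)
      rw [if_pos rfl] at h1
      have h2 := (isHomogeneous_cubicP K).sum_X_mul_pderiv
      rw [← Finset.add_sum_erase _ _ (Finset.mem_univ (Sum.inl 0 : E6Var)), nsmul_eq_mul] at h2
      have h3 : ∑ u ∈ Finset.univ.erase (Sum.inl 0 : E6Var), X u * pderiv u (cubicP K) ∈ J :=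
        sum_mem fun u hu => Ideal.mul_mem_left _ _ (hne u (Finset.ne_of_mem_erase hu))
      have h4 : C (4 : K) * (X (.inl 0) * pderiv (.inl 0) (cubicP K)) ∈ J := by
        convert add_mem (Ideal.mul_mem_left _ 3 h1) (neg_mem h3) using 1
        rw [eq_sub_of_add_eq' h2, map_ofNat]
        push_cast
        ring
      have h5 := Ideal.mul_mem_left _ (C (4 : K)⁻¹) h4
      rw [← mul_assoc, ← C_mul, inv_mul_cancel₀ (by norm_num), C_1, one_mul] at h5
      exact (this.mem_or_mem h5).resolve_left hXt
    · exact hne u hu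
  refine le_antisymm hle fun f hf => ?_
  obtain ⟨k, hk⟩ := (mem_ker_elimHom_iff ht hq f).mp hf
  exact (isAdjointCubic_cubicP K).mem_of_pow_mul_mem four_pos
    (fun k hk => hXt (this.mem_of_pow_mem k (hle hk))) (elimIdeal_le_gradIdeal K hk)

end E6

/-- In characteristic `0`, the ideal of the 27 partial derivatives of the cubic
invariant `P` is prime of height `10`. -/
theorem statement13 (K : Type*) [Field K] [CharZero K] :
    ∃ hP : (e6Ideal K).IsPrime,
      Order.height (⟨e6Ideal K, hP⟩ : PrimeSpectrum (MvPolynomial E6Var K)) =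
        (10 : ℕ) := by
  have h : e6Ideal K = RingHom.ker (elimHom (.inl 0) (elimRest K) elimVars) :=
    gradIdeal_eq_ker_elimHom K
  have hP : (e6Ideal K).IsPrime := h ▸ RingHom.ker_isPrime _
  refine ⟨hP, ?_⟩
  have hq : ∀ v ∈ elimVars, elimRest K v ∈ supported K ((elimVars : Set E6Var)ᶜ) :=
    fun v hv => elimRest_mem_supported K hv
  rw [← PrimeSpectrum.height_eq_orderHeight, ← card_elimVars]
  change (e6Ideal K).height = _
  rw [h]
  exact le_antisymm (height_ker_elimHom_le inl_zero_notMem_elimVars hq)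
    (le_height_ker_elimHom inl_zero_notMem_elimVars hq)
end
end
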